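/- arXiv:1405.2175 — 5 statements merged into one kernel-verified Lean document; each statement's English description precedes it below -/
import Mathlib

section
/- Let s and t be coprime positive integers. Then the set of partitions that are self-conjugate (s,t)-cores is finite, and the sum of the sizes of all self-conjugate (s,t)-core partitions equals ((s+t+1)(s-1)(t-1)/24) · C(⌊s/2⌋+⌊t/2⌋, ⌊s/2⌋); equivalently, the average size of a self-conjugate (s,t)-core partition is (s+t+1)(s-1)(t-1)/24. -/
/-- A partition, given by its (0-indexed) weakly decreasing sequence of parts,
which is eventually zero. Row `i` of the Young diagram has `parts i` cells;
the diagram consists of the (0-indexed) cells `(i, j)` with `j < parts i`. -/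
structure YPartition where
  parts : ℕ → ℕ
  antitone : ∀ ⦃i j : ℕ⦄, i ≤ j → parts j ≤ parts i
  finite_support : ∃ N, ∀ i, N ≤ i → parts i = 0

namespace YPartition

/-- The `j`-th (0-indexed) part of the conjugate partition: the number of rows
whose length exceeds `j`. -/
noncomputable def conj (p : YPartition) (j : ℕ) : ℕ := Set.ncard {i : ℕ | j < p.parts i}

/-- The set of (0-indexed) cells of the Young diagram. -/
def cells (p : YPartition) : Set (ℕ × ℕ) := {c | c.2 < p.parts c.1}

/-- The size of a partition: the number of cells of its Young diagram. -/
noncomputable def size (p : YPartition) : ℕ := p.cells.ncard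

/-- The hook length of the (0-indexed) cell `(i, j)`:
`λ_i − j + λ'_j − i + 1` in 1-indexed terms. -/
noncomputable def hook (p : YPartition) (i j : ℕ) : ℕ := p.parts i + p.conj j - i - j - 1

/-- A partition is self-conjugate if it equals its conjugate. -/
def SelfConj (p : YPartition) : Prop := ∀ j, p.conj j = p.parts j

/-- A partition is a `t`-core if no cell of its diagram has hook length `t`. -/
def IsCore (t : ℕ) (p : YPartition) : Prop :=
  ∀ i j : ℕ, (i, j) ∈ p.cells → p.hook i j ≠ t

/-- The set of hook lengths of the main diagonal cells. -/
def MD (p : YPartition) : Set ℕ := {h | ∃ i : ℕ, i < p.parts i ∧ h = p.hook i i}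

end YPartition

namespace YPartition

lemma lt_conj_iff (p : YPartition) (i j : ℕ) : i < p.conj j ↔ j < p.parts i := by
  classical
  have hex : ∃ c, p.parts c ≤ j := by
    obtain ⟨N, hN⟩ := p.finite_support
    exact ⟨N, by rw [hN N le_rfl]; exact Nat.zero_le _⟩
  have key : ∀ i, j < p.parts i ↔ i < Nat.find hex := by
    intro i
    constructor
    · intro h
      by_contra hc
      have h1 := p.antitone (not_lt.mp hc)
      have h2 := Nat.find_spec hex
      omega
    · intro h
      have := Nat.find_min hex h
      omega
  have : p.conj j = Nat.find hex := by
    unfold conj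
    have : {i : ℕ | j < p.parts i} = ((Finset.range (Nat.find hex) : Finset ℕ) : Set ℕ) := by
      ext i
      simp only [Set.mem_ofPred_eq, Finset.coe_range, Set.mem_Iio]
      exact key i
    rw [this, Set.ncard_coe_finset, Finset.card_range]
  rw [this, key]

lemma selfConj_iff (p : YPartition) :
    p.SelfConj ↔ ∀ i j, j < p.parts i ↔ i < p.parts j := by
  constructor
  · intro h i j
    rw [← h j, lt_conj_iff]
  · intro h j
    apply eq_of_forall_lt_iff
    intro i
    rw [lt_conj_iff, h]

/-- beta set -/
def bset (p : YPartition) : Set ℤ := Set.range fun i : ℕ => (p.parts i : ℤ) - i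

lemma mono_b (p : YPartition) : StrictMono fun i : ℕ => -((p.parts i : ℤ) - i) := by
  apply strictMono_nat_of_lt_succ
  intro n
  have := p.antitone (Nat.le_succ n)
  simp only [Nat.succ_eq_add_one] at this
  push_cast
  omega

lemma bset_inj {p q : YPartition} (h : p.bset = q.bset) : p = q := by
  have h1 : (fun i : ℕ => -((p.parts i : ℤ) - i)) = fun i : ℕ => -((q.parts i : ℤ) - i) := by
    rw [← (mono_b p).range_inj (mono_b q)]
    have e : ∀ r : YPartition, Set.range (fun i : ℕ => -((r.parts i : ℤ) - i))
        = (fun x => -x) '' r.bset := by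
      intro r
      unfold bset
      rw [← Set.range_comp]
      rfl
    rw [e, e, h]
  have h2 : p.parts = q.parts := by
    funext i
    have := congrFun h1 i
    omega
  cases p; cases q; simp at h2; subst h2; rfl

lemma symm_b {p : YPartition} (h : p.SelfConj) (b : ℤ) : b ∈ p.bset ↔ 1 - b ∉ p.bset := by
  classical
  rw [selfConj_iff] at h
  constructor
  · rintro ⟨i, hi⟩ ⟨j, hj⟩
    simp only at hi hj
    have := h i j
    omega
  · intro hb
    by_contra hb2
    apply hb
    have hex : ∃ i : ℕ, (p.parts i : ℤ) - i ≤ b := by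
      obtain ⟨N, hN⟩ := p.finite_support
      refine ⟨max N b.natAbs, ?_⟩
      rw [hN _ (le_max_left _ _)]
      have := le_max_right N b.natAbs
      omega
    set i := Nat.find hex with hi
    have h1 : (p.parts i : ℤ) - i ≤ b := Nat.find_spec hex
    have h2 : (p.parts i : ℤ) - i ≠ b := fun e => hb2 ⟨i, e⟩
    have h3 : ∀ m < i, ¬ ((p.parts m : ℤ) - m ≤ b) := fun m hm => Nat.find_min hex hm
    obtain ⟨j, hj⟩ : ∃ j : ℕ, (j : ℤ) = b + i - 1 := ⟨(b + i - 1).toNat, by omega⟩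
    refine ⟨j, ?_⟩
    have h4 := h i j
    simp only
    rcases Nat.eq_zero_or_pos i with h0 | h0
    · omega
    · have h5 := h3 (i-1) (by omega)
      have h6 := h (i-1) j
      omega

lemma core_iff {p : YPartition} (h : p.SelfConj) (t : ℕ) :
    IsCore t p ↔ ∀ b ∈ p.bset, b - t ∈ p.bset := by
  have hs := symm_b h
  have h' := (selfConj_iff p).1 h
  constructor
  · rintro hc b ⟨i, hi⟩
    by_contra hb
    rw [hs, not_not] at hb
    obtain ⟨j, hj⟩ := hb
    simp only at hi hj
    have := h' i j
    have hcell : j < p.parts i := by omega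
    apply hc i j hcell
    unfold hook
    rw [h j]
    omega
  · intro hc i j hij hk
    have hij' : j < p.parts i := hij
    have := h' i j
    unfold hook at hk
    rw [h j] at hk
    have h1 := hc _ ⟨i, rfl⟩
    rw [hs] at h1
    apply h1
    refine ⟨j, ?_⟩
    simp only
    omega

lemma bdd_b (p : YPartition) : ∃ N : ℤ, ∀ b ∈ p.bset, b ≤ N := by
  refine ⟨p.parts 0, ?_⟩
  rintro b ⟨i, rfl⟩
  have := p.antitone (Nat.zero_le i)
  simp only
  omega

lemma exists_of_symm (S : Set ℤ) (hb : ∃ N : ℤ, ∀ b ∈ S, b ≤ N)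
    (hS : ∀ b, b ∈ S ↔ 1 - b ∉ S) : ∃ p : YPartition, p.SelfConj ∧ p.bset = S := by
  classical
  obtain ⟨M, hM⟩ := hb
  have hfin : ∀ x : ℤ, {b | b ∈ S ∧ x < b}.Finite := fun x =>
    (Set.finite_Ioc x M).subset fun b hb => ⟨hb.2, hM b hb.1⟩
  let N : ℤ → ℕ := fun x => {b | b ∈ S ∧ x < b}.ncard
  have step1 : ∀ x, x ∈ S → N (x-1) = N x + 1 := by
    intro x hx
    have : {b | b ∈ S ∧ x - 1 < b} = insert x {b | b ∈ S ∧ x < b} := by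
      ext b
      simp only [Set.mem_ofPred_eq, Set.mem_insert_iff]
      constructor
      · rintro ⟨h1, h2⟩
        by_cases e : b = x
        · exact Or.inl e
        · exact Or.inr ⟨h1, by omega⟩
      · rintro (rfl | ⟨h1, h2⟩)
        · exact ⟨hx, by omega⟩
        · exact ⟨h1, by omega⟩
    simp only [N]
    rw [this, Set.ncard_insert_of_notMem (by simp) (hfin x)]
  have step0 : ∀ x, x ∉ S → N (x-1) = N x := by
    intro x hx
    simp only [N]
    congr 1
    ext b
    simp only [Set.mem_ofPred_eq]
    constructor
    · rintro ⟨h1, h2⟩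
      refine ⟨h1, ?_⟩
      have : b ≠ x := fun e => hx (e ▸ h1)
      omega
    · rintro ⟨h1, h2⟩
      exact ⟨h1, by omega⟩
  have anti : ∀ x, N x ≤ N (x-1) ∧ N (x-1) ≤ N x + 1 := by
    intro x
    by_cases hx : x ∈ S
    · rw [step1 x hx]; omega
    · rw [step0 x hx]; omega
  have anti' : ∀ x y, x ≤ y → N y ≤ N x := by
    intro x y hxy
    exact Set.ncard_le_ncard (fun b hb => ⟨hb.1, lt_of_le_of_lt hxy hb.2⟩) (hfin x)
  have refl0 : ∀ n : ℕ, (N (-(n:ℤ)) : ℤ) = N n + n := by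
    intro n
    induction n with
    | zero => simp
    | succ n ih =>
      by_cases hx : ((n:ℤ) + 1) ∈ S
      · have h2 : -(n:ℤ) ∉ S := by
          rw [hS] at hx
          convert hx using 2
          ring
        have e1 := step1 _ hx
        have e2 := step0 _ h2
        push_cast
        rw [show (-((n:ℤ)+1)) = -(n:ℤ) - 1 by ring, e2, ih]
        rw [show ((n:ℤ)+1-1) = n by ring] at e1
        rw [e1]; push_cast; ring
      · have h2 : -(n:ℤ) ∈ S := by
          rw [hS]
          convert hx using 2
          ring
        have e1 := step0 _ hx
        have e2 := step1 _ h2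
        push_cast
        rw [show (-((n:ℤ)+1)) = -(n:ℤ) - 1 by ring, e2]
        push_cast
        rw [ih]
        rw [show ((n:ℤ)+1-1) = n by ring] at e1
        rw [e1]; ring
  have refl : ∀ x : ℤ, (N (-x) : ℤ) = N x + x := by
    intro x
    obtain ⟨n, rfl | rfl⟩ := x.eq_nat_or_neg
    · exact refl0 n
    · have := refl0 n
      rw [neg_neg, this]; ring
  have hzero : ∀ x, M ≤ x → N x = 0 := by
    intro x hx
    have : {b | b ∈ S ∧ x < b} = ∅ := by
      ext b
      simp only [Set.mem_ofPred_eq, Set.mem_empty_iff_false, iff_false]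
      rintro ⟨h1, h2⟩
      have := hM b h1
      omega
    simp only [N, this, Set.ncard_empty]
  have hex : ∀ i : ℕ, ∃ j : ℕ, N ((j:ℤ) - i) ≤ i := by
    intro i
    refine ⟨M.natAbs + i, ?_⟩
    rw [hzero _ (by rw [Nat.cast_add]; omega)]
    omega
  have key : ∀ i j : ℕ, j < Nat.find (hex i) ↔ i < N ((j:ℤ) - i) := by
    intro i j
    constructor
    · intro h
      have := Nat.find_min (hex i) h
      omega
    · intro h
      by_contra hc
      have h1 := Nat.find_spec (hex i)
      have h2 := anti' ((Nat.find (hex i) : ℤ) - i) ((j:ℤ) - i) (by omega)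
      omega
  have hanti : Antitone fun i => Nat.find (hex i) := by
    apply antitone_nat_of_succ_le
    intro n
    by_contra hc
    push Not at hc
    rw [key] at hc
    have h1 := Nat.find_spec (hex n)
    have h2 := (anti ((Nat.find (hex n) : ℤ) - n)).2
    push_cast at hc
    rw [show ((Nat.find (hex n) : ℤ) - (n+1)) = (Nat.find (hex n) : ℤ) - n - 1 by ring] at hc
    omega
  let p : YPartition := ⟨fun i => Nat.find (hex i), fun i j h => hanti h, by
    refine ⟨M.natAbs, fun i hi => ?_⟩
    by_contra hc
    have h1 := (key i 0).1 (Nat.pos_of_ne_zero hc)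
    have h2 := refl i
    rw [hzero i (by omega)] at h2
    simp only [Nat.cast_zero, zero_sub] at h1
    omega⟩
  have hp : ∀ i j : ℕ, j < p.parts i ↔ i < N ((j:ℤ) - i) := key
  have hpc : p.SelfConj := by
    rw [selfConj_iff]
    intro i j
    rw [hp, hp]
    have := refl ((j:ℤ) - i)
    rw [neg_sub] at this
    omega
  have hsub : S ⊆ p.bset := by
    intro b hbS
    have h1 := refl b
    obtain ⟨j, hj⟩ : ∃ j : ℕ, (j:ℤ) = b + N b := ⟨(b + N b).toNat, by omega⟩
    refine ⟨N b, ?_⟩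
    have h2 := hp (N b) j
    rw [show (j:ℤ) - N b = b by omega] at h2
    have h3 : j ≤ p.parts (N b) := by
      by_contra hc
      push Not at hc
      obtain ⟨j', rfl⟩ : ∃ j', j = j' + 1 := ⟨j - 1, by omega⟩
      have h4 := hp (N b) j'
      push_cast at hj
      rw [show (j':ℤ) - N b = b - 1 by omega, step1 b hbS] at h4
      omega
    simp only
    omega
  refine ⟨p, hpc, Set.Subset.antisymm ?_ hsub⟩
  intro b hbp
  by_contra hc
  rw [symm_b hpc] at hbp
  apply hbp
  apply hsub
  rw [hS]
  simpa using hc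

end YPartition

namespace YPartition

lemma size_eq_sum (p : YPartition) (n : ℕ) (hn : ∀ i, n ≤ i → p.parts i = 0) :
    p.size = ∑ i ∈ Finset.range n, p.parts i := by
  classical
  have hc : p.cells = ((((Finset.range n).sigma (fun i => Finset.range (p.parts i))).image
      (fun x : (_ : ℕ) × ℕ => (x.1, x.2)) : Finset (ℕ × ℕ)) : Set (ℕ × ℕ)) := by
    ext ⟨i, j⟩
    simp only [cells, Set.mem_ofPred_eq, Finset.coe_image, Set.mem_image, Finset.mem_coe,
      Finset.mem_sigma, Finset.mem_range]
    constructor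
    · intro h
      refine ⟨⟨i, j⟩, ⟨?_, h⟩, rfl⟩
      by_contra hc
      simp only at hc
      rw [hn i (by omega)] at h
      omega
    · rintro ⟨⟨a, b⟩, ⟨h1, h2⟩, h3⟩
      simp only [Prod.mk.injEq] at h3
      obtain ⟨rfl, rfl⟩ := h3
      exact h2
  unfold size
  rw [hc, Set.ncard_coe_finset, Finset.card_image_of_injective, Finset.card_sigma]
  · simp
  · rintro ⟨a, b⟩ ⟨c, d⟩ h
    simp only [Prod.mk.injEq] at h
    obtain ⟨rfl, rfl⟩ := h
    rfl

lemma sum_range_id (n : ℕ) : 2 * ∑ i ∈ Finset.range n, (i:ℤ) = n * (n - 1) := by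
  induction n with
  | zero => simp
  | succ n ih => rw [Finset.sum_range_succ, mul_add, ih]; push_cast; ring

lemma sum_Ioc_g (s n : ℤ) (m : ℕ) :
    6 * ∑ x ∈ Finset.Ioc (-n - m) (-n), x * (x + s)
      = m * (6 * n * n + 6 * n * (m - 1) + (m - 1) * (2 * m - 1) - 6 * n * s - 3 * s * (m - 1)) := by
  induction m with
  | zero => simp
  | succ m ih =>
    have : Finset.Ioc (-n - ((m+1:ℕ):ℤ)) (-n) = insert (-n - m) (Finset.Ioc (-n - m) (-n)) := by
      ext x
      simp only [Finset.mem_Ioc, Finset.mem_insert]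
      push_cast
      omega
    rw [this, Finset.sum_insert (by simp), mul_add, ih]
    push_cast
    ring

/-- size via the set of tops -/
lemma size_tops (p : YPartition) (s : ℕ) (T : Finset ℤ) (hs : 0 < s)
    (hcl : ∀ b ∈ p.bset, b - s ∈ p.bset)
    (hT : ∀ b, b ∈ T ↔ b ∈ p.bset ∧ b + s ∉ p.bset) :
    12 * (s : ℤ) * p.size = 6 * ∑ x ∈ T, x * (x + s) + s * (s - 1) * (s + 1) := by
  classical
  obtain ⟨n, hn⟩ := p.finite_support
  rw [size_eq_sum p n hn]
  have binj : Function.Injective (fun i : ℕ => (p.parts i : ℤ) - i) := by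
    intro i j h
    apply (mono_b p).injective
    simp only at h ⊢
    rw [h]
  set A : Finset ℤ := (Finset.range n).image (fun i : ℕ => (p.parts i : ℤ) - i) with hA
  have hAsum : ∑ x ∈ A, x = ∑ i ∈ Finset.range n, (p.parts i : ℤ) - ∑ i ∈ Finset.range n, (i:ℤ) := by
    rw [hA, Finset.sum_image (fun i _ j _ h => binj h), Finset.sum_sub_distrib]
  have hlow : ∀ b : ℤ, b ≤ -n → b ∈ p.bset := by
    intro b hb
    refine ⟨(-b).toNat, ?_⟩
    simp only
    rw [hn _ (by omega)]
    omega
  have hAmem : ∀ b : ℤ, b ∈ A ↔ b ∈ p.bset ∧ -(n:ℤ) < b := by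
    intro b
    simp only [hA, Finset.mem_image, Finset.mem_range]
    constructor
    · rintro ⟨i, hi, rfl⟩
      exact ⟨⟨i, rfl⟩, by omega⟩
    · rintro ⟨⟨i, rfl⟩, h⟩
      refine ⟨i, ?_, rfl⟩
      by_contra hc
      simp only at h
      rw [hn i (by omega)] at h
      omega
  set I : Finset ℤ := Finset.Ioc (-(n:ℤ) - (s:ℕ)) (-n) with hI
  set A' : Finset ℤ := A.image (fun x => x - (s:ℤ)) with hA'
  have hA'mem : ∀ b : ℤ, b ∈ A' ↔ b + s ∈ p.bset ∧ -(n:ℤ) < b + s := by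
    intro b
    rw [← hAmem, hA', Finset.mem_image]
    constructor
    · rintro ⟨x, hx, rfl⟩
      simpa using hx
    · intro h
      exact ⟨_, h, by ring⟩
  have d1 : Disjoint A I := by
    rw [Finset.disjoint_left]
    intro b h1 h2
    rw [hAmem] at h1
    rw [hI, Finset.mem_Ioc] at h2
    omega
  have d2 : Disjoint A' T := by
    rw [Finset.disjoint_left]
    intro b h1 h2
    rw [hA'mem] at h1
    rw [hT] at h2
    exact h2.2 h1.1
  have hU : A ∪ I = A' ∪ T := by
    ext b
    simp only [Finset.mem_union, hAmem, hA'mem, hT, hI, Finset.mem_Ioc]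
    have h1 := hcl (b + s)
    rw [add_sub_cancel_right] at h1
    have h2 := hlow b
    have h3 := hlow (b + s)
    by_cases c1 : b ∈ p.bset <;> by_cases c2 : b + s ∈ p.bset <;> simp only [c1, c2] at * <;>
      simp at * <;> omega
  have e : ∑ x ∈ A, x * (x + s) + ∑ x ∈ I, x * (x + s)
      = ∑ x ∈ A, (x - s) * x + ∑ x ∈ T, x * (x + s) := by
    rw [← Finset.sum_union d1, hU, Finset.sum_union d2, hA',
      Finset.sum_image (fun i _ j _ h => by simpa using h)]
    simp
  have e2 : ∑ x ∈ A, x * (x + s) - ∑ x ∈ A, (x - s) * x = 2 * s * ∑ x ∈ A, x := by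
    rw [← Finset.sum_sub_distrib, Finset.mul_sum]
    apply Finset.sum_congr rfl
    intros; ring
  have e3 := sum_Ioc_g s n s
  have e4 := sum_range_id n
  push_cast
  rw [← hI] at e3
  linear_combination (-12 * (s:ℤ)) * hAsum - 6 * e2 + 6 * e - e3 + 6 * (s:ℤ) * e4

end YPartition

/-- monotone sequences -/
noncomputable def QQ : ℕ → ℕ → Finset (ℕ → ℕ)
  | 0, _ => {0}
  | _ + 1, 0 => {0}
  | k + 1, h + 1 => by
    classical
    exact QQ (k + 1) h ∪ (QQ k (h + 1)).image (fun f => Function.update f (k + 1) (h + 1))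

lemma mem_QQ (k h : ℕ) (f : ℕ → ℕ) :
    f ∈ QQ k h ↔ f 0 = 0 ∧ (∀ j < k, f j ≤ f (j+1)) ∧ f k ≤ h ∧ ∀ j, k < j → f j = 0 := by
  induction k, h using QQ.induct generalizing f with
  | case1 h =>
    simp only [QQ, Finset.mem_singleton]
    constructor
    · rintro rfl; simp
    · rintro ⟨h0, -, -, h1⟩
      funext j
      rcases Nat.eq_zero_or_pos j with rfl | hj
      · exact h0
      · exact h1 j hj
  | case2 k =>
    simp only [QQ, Finset.mem_singleton]
    constructor
    · rintro rfl; simp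
    · rintro ⟨h0, h1, h2, h3⟩
      have : ∀ i, i ≤ k + 1 → f (k + 1 - i) = 0 := by
        intro i
        induction i with
        | zero => intro _; simpa using h2
        | succ i ih =>
          intro hi
          have e1 := ih (by omega)
          have e2 := h1 (k + 1 - (i+1)) (by omega)
          rw [show k + 1 - (i+1) + 1 = k + 1 - i by omega, e1] at e2
          omega
      funext j
      by_cases hj : j ≤ k + 1
      · have := this (k + 1 - j) (by omega)
        rwa [show k + 1 - (k + 1 - j) = j by omega] at this
      · exact h3 j (by omega)
  | case3 k h ih1 ih2 =>
    simp only [QQ, Finset.mem_union, Finset.mem_image, ih1, ih2, Nat.succ_eq_add_one]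
    constructor
    · rintro (⟨h0, h1, h2, h3⟩ | ⟨g, ⟨h0, h1, h2, h3⟩, rfl⟩)
      · exact ⟨h0, h1, by omega, h3⟩
      · refine ⟨by simpa [Function.update] using h0, ?_, by simp, ?_⟩
        · intro j hj
          rcases Nat.lt_succ_iff_lt_or_eq.1 hj with hj' | rfl
          · rw [Function.update_of_ne (by omega), Function.update_of_ne (by omega)]
            exact h1 j hj'
          · rw [Function.update_of_ne (by omega), Function.update_self]
            exact h2
        · intro j hj
          rw [Function.update_of_ne (by omega)]
          exact h3 j (by omega)
    · rintro ⟨h0, h1, h2, h3⟩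
      by_cases hh : f (k + 1) ≤ h
      · exact Or.inl ⟨h0, h1, hh, h3⟩
      · right
        refine ⟨Function.update f (k+1) 0, ⟨?_, ?_, ?_, ?_⟩, ?_⟩
        · rw [Function.update_of_ne (by omega)]; exact h0
        · intro j hj
          rw [Function.update_of_ne (by omega), Function.update_of_ne (by omega)]
          exact h1 j (by omega)
        · rw [Function.update_of_ne (by omega)]
          have := h1 k (by omega)
          omega
        · intro j hj
          by_cases e : j = k + 1
          · subst e; simp
          · rw [Function.update_of_ne e]
            exact h3 j (by omega)
        · rw [Function.update_idem]
          have : h + 1 = f (k + 1) := by omega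
          rw [this, Function.update_eq_self]

lemma QQ_succ_sum (k h : ℕ) (F : (ℕ → ℕ) → ℤ) :
    ∑ f ∈ QQ (k + 1) (h + 1), F f = ∑ f ∈ QQ (k + 1) h, F f +
      ∑ f ∈ QQ k (h + 1), F (Function.update f (k + 1) (h + 1)) := by
  classical
  have : QQ (k + 1) (h + 1) = QQ (k + 1) h ∪
      (QQ k (h + 1)).image (fun f => Function.update f (k + 1) (h + 1)) := by
    ext f
    simp [QQ]
  rw [this, Finset.sum_union, Finset.sum_image]
  · intro f hf g hg hfg
    rw [Finset.mem_coe, mem_QQ] at hf hg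
    funext j
    by_cases e : j = k + 1
    · rw [hf.2.2.2 j (by omega), hg.2.2.2 j (by omega)]
    · have := congrFun hfg j
      simpa [Function.update_of_ne e] using this
  · rw [Finset.disjoint_left]
    intro f h1 h2
    rw [mem_QQ] at h1
    obtain ⟨g, -, rfl⟩ := Finset.mem_image.1 h2
    have := h1.2.2.1
    simp at this

lemma QQ_card (k h : ℕ) : (∑ _f ∈ QQ k h, (1:ℤ)) = (k + h).choose k := by
  induction k, h using QQ.induct with
  | case1 h => simp [QQ]
  | case2 k => simp [QQ]
  | case3 k h ih1 ih2 =>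
    rw [QQ_succ_sum, ih1, ih2]
    rw [show k + 1 + (h + 1) = (k + (h + 1)) + 1 by ring, Nat.choose_succ_succ,
      show k + 1 + h = k + (h + 1) by ring]
    push_cast; ring

lemma sum_sq_range (k : ℕ) : 6 * ∑ j ∈ Finset.range (k + 1), (j:ℤ)^2 = k * (k + 1) * (2 * k + 1) := by
  induction k with
  | zero => simp
  | succ k ih => rw [Finset.sum_range_succ, mul_add, ih]; push_cast; ring

lemma QQ_sum (a b : ℤ) (k h : ℕ) :
    6 * ∑ f ∈ QQ k h, ∑ j ∈ Finset.range (k + 1), (a * f j - b * j)^2 =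
      (k + h).choose k * (a^2 * k * h * (2 * h + 1) - 2 * a * b * h * k * (2 * k + 1)
        + b^2 * k * (k + 1) * (2 * k + 1)) := by
  induction k, h using QQ.induct with
  | case1 h => simp [QQ]
  | case2 k =>
    simp only [QQ, Finset.sum_singleton, Pi.zero_apply]
    have := sum_sq_range (k + 1)
    have e : ∑ j ∈ Finset.range (k + 1 + 1), (a * ((0:ℕ):ℤ) - b * j)^2
        = b^2 * ∑ j ∈ Finset.range (k + 1 + 1), (j:ℤ)^2 := by
      rw [Finset.mul_sum]; apply Finset.sum_congr rfl; intros; push_cast; ring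
    rw [e]
    simp only [add_zero, Nat.choose_self]
    push_cast at this ⊢
    linear_combination b^2 * this
  | case3 k h ih1 ih2 =>
    simp only [Nat.succ_eq_add_one]
    rw [QQ_succ_sum]
    have e : ∑ f ∈ QQ k (h + 1), ∑ j ∈ Finset.range (k + 1 + 1),
          (a * (Function.update f (k + 1) (h + 1) j : ℕ) - b * j)^2
        = ∑ f ∈ QQ k (h + 1), ∑ j ∈ Finset.range (k + 1), (a * f j - b * j)^2
          + (a * (h + 1) - b * (k + 1))^2 * ∑ f ∈ QQ k (h + 1), (1:ℤ) := by
      rw [Finset.mul_sum, ← Finset.sum_add_distrib]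
      apply Finset.sum_congr rfl
      intro f _
      rw [Finset.sum_range_succ]
      congr 1
      · apply Finset.sum_congr rfl
        intro j hj
        rw [Finset.mem_range] at hj
        rw [Function.update_of_ne (by omega)]
      · rw [Function.update_self]; push_cast; ring
    rw [e, QQ_card]
    have hrel : (((k + (h + 1)).choose (k + 1) : ℕ) : ℤ) * (k + 1)
        = ((k + (h + 1)).choose k : ℕ) * (h + 1) := by
      have := Nat.choose_succ_right_eq (k + (h + 1)) k
      rw [show k + (h + 1) - k = h + 1 by omega] at this
      exact_mod_cast this
    rw [show k + 1 + h = k + (h + 1) by ring] at ih1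
    rw [show k + 1 + (h + 1) = (k + (h + 1)) + 1 by ring, Nat.choose_succ_succ,
      Nat.succ_eq_add_one]
    generalize (k + (h + 1)).choose (k + 1) = Y at *
    generalize (k + (h + 1)).choose k = X at *
    push_cast at ih1 ih2 hrel ⊢
    linear_combination ih1 + ih2 + (-a^2 * (4 * h + 3) + 2 * a * b * (2 * k + 3)) * hrel

/-- odd extension -/
def oext (f : ℕ → ℕ) (j : ℤ) : ℤ := j.sign * f j.natAbs

lemma oext_neg (f : ℕ → ℕ) (j : ℤ) : oext f (-j) = - oext f j := by
  simp [oext]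

lemma oext_nat (f : ℕ → ℕ) (h0 : f 0 = 0) (j : ℕ) : oext f j = f j := by
  rcases Nat.eq_zero_or_pos j with rfl | hj
  · simp [oext, h0]
  · simp [oext, Int.sign_natCast_of_ne_zero hj.ne']

lemma oext_step (k h : ℕ) (f : ℕ → ℕ) (hf : f ∈ QQ k h) (j : ℤ) (h1 : -(k:ℤ) ≤ j) (h2 : j < k) :
    oext f j ≤ oext f (j + 1) := by
  rw [mem_QQ] at hf
  obtain ⟨h0, hm, -, -⟩ := hf
  rcases le_or_gt 0 j with hj | hj
  · obtain ⟨n, rfl⟩ := Int.eq_ofNat_of_zero_le hj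
    rw [oext_nat f h0, show ((n:ℤ) + 1) = ((n+1:ℕ):ℤ) by push_cast; ring, oext_nat f h0]
    exact_mod_cast hm n (by omega)
  · obtain ⟨n, hn⟩ : ∃ n : ℕ, (n:ℤ) = -j - 1 := ⟨(-j-1).toNat, by omega⟩
    have e1 : j = -((n+1:ℕ):ℤ) := by push_cast; omega
    have e2 : j + 1 = -(n:ℤ) := by omega
    rw [e2, e1, oext_neg, oext_neg, oext_nat f h0, oext_nat f h0]
    have := hm n (by omega)
    omega

/-- the set attached to a sequence -/
def SS (k t : ℕ) (f : ℕ → ℕ) : Set ℤ :=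
  {b | ∃ a j : ℤ, -(k:ℤ) ≤ j ∧ j ≤ k ∧ b + k = (2 * k + 1) * a - t * j ∧ a ≤ oext f j}

lemma rep_exists (k t : ℕ) (hc : Nat.Coprime (2 * k + 1) t) (u : ℤ) :
    ∃ a j : ℤ, -(k:ℤ) ≤ j ∧ j ≤ k ∧ u = (2 * k + 1) * a - t * j := by
  have hc' : IsCoprime ((2 * k + 1 : ℕ) : ℤ) (t : ℤ) := Nat.isCoprime_iff_coprime.2 hc
  obtain ⟨x, y, hxy⟩ := hc'
  push_cast at hxy
  have hm := Int.emod_add_mul_ediv (-u * y + k) (2 * k + 1)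
  have h1 := Int.emod_nonneg (-u * y + k) (show (2 * (k:ℤ) + 1) ≠ 0 by omega)
  have h2 := Int.emod_lt_of_pos (-u * y + k) (show 0 < (2 * (k:ℤ) + 1) by omega)
  set r := (-u * y + k) % (2 * k + 1)
  set q := (-u * y + k) / (2 * k + 1)
  refine ⟨u * x - t * q, r - k, by omega, by omega, ?_⟩
  linear_combination (-u) * hxy + t * hm

lemma rep_unique (k t : ℕ) (hc : Nat.Coprime (2 * k + 1) t) (a j a' j' : ℤ)
    (h1 : -(k:ℤ) ≤ j) (h2 : j ≤ k) (h1' : -(k:ℤ) ≤ j') (h2' : j' ≤ k)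
    (h : (2 * k + 1) * a - t * j = (2 * k + 1) * a' - t * j') : a = a' ∧ j = j' := by
  have hc' : IsCoprime ((2 * k + 1 : ℕ) : ℤ) (t : ℤ) := Nat.isCoprime_iff_coprime.2 hc
  have hd : ((2 * k + 1 : ℕ) : ℤ) ∣ t * (j - j') := ⟨a - a', by push_cast; linear_combination -h⟩
  have hd2 := hc'.dvd_of_dvd_mul_left hd
  have hj : j - j' = 0 := by
    apply Int.eq_zero_of_abs_lt_dvd hd2
    rw [abs_lt]; push_cast; constructor <;> omega
  have hj' : j = j' := by omega
  subst hj'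
  refine ⟨?_, rfl⟩
  have : (2 * (k:ℤ) + 1) * (a - a') = 0 := by linear_combination h
  rcases mul_eq_zero.1 this with h3 | h3 <;> omega

lemma mem_SS (k t : ℕ) (hc : Nat.Coprime (2 * k + 1) t) (f : ℕ → ℕ) (a j : ℤ)
    (h1 : -(k:ℤ) ≤ j) (h2 : j ≤ k) (b : ℤ) (hb : b + k = (2 * k + 1) * a - t * j) :
    b ∈ SS k t f ↔ a ≤ oext f j := by
  constructor
  · rintro ⟨a', j', h1', h2', hb', h⟩
    obtain ⟨rfl, rfl⟩ := rep_unique k t hc a j a' j' h1 h2 h1' h2' (by rw [← hb, ← hb'])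
    exact h
  · intro h
    exact ⟨a, j, h1, h2, hb, h⟩

lemma SS_symm (k t : ℕ) (hc : Nat.Coprime (2 * k + 1) t) (f : ℕ → ℕ) (b : ℤ) :
    b ∈ SS k t f ↔ 1 - b ∉ SS k t f := by
  obtain ⟨a, j, h1, h2, h⟩ := rep_exists k t hc (b + k)
  rw [mem_SS k t hc f a j h1 h2 b h,
    mem_SS k t hc f (1 - a) (-j) (by omega) (by omega) (1 - b) (by linear_combination -h), oext_neg]
  omega

lemma SS_s (k t : ℕ) (hc : Nat.Coprime (2 * k + 1) t) (f : ℕ → ℕ) (b : ℤ)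
    (hb : b ∈ SS k t f) : b - (2 * k + 1 : ℕ) ∈ SS k t f := by
  obtain ⟨a, j, h1, h2, h, h3⟩ := hb
  exact ⟨a - 1, j, h1, h2, by push_cast; linear_combination h, by omega⟩

lemma SS_t (k t : ℕ) (hc : Nat.Coprime (2 * k + 1) t) (f : ℕ → ℕ) (hf : f ∈ QQ k (t / 2)) (b : ℤ)
    (hb : b ∈ SS k t f) : b - t ∈ SS k t f := by
  obtain ⟨a, j, h1, h2, h, h3⟩ := hb
  by_cases hj : j < k
  · exact ⟨a, j + 1, by omega, by omega, by linear_combination h,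
      h3.trans (oext_step k _ f hf j h1 hj)⟩
  · have hj' : j = k := by omega
    subst hj'
    refine ⟨a - t, -k, by omega, by omega, by linear_combination h, ?_⟩
    rw [oext_neg]
    rw [mem_QQ] at hf
    rw [oext_nat f hf.1] at *
    have := hf.2.2.1
    omega

lemma SS_bdd (k t : ℕ) (f : ℕ → ℕ) : ∃ N : ℤ, ∀ b ∈ SS k t f, b ≤ N := by
  refine ⟨∑ j ∈ Finset.Icc (-(k:ℤ)) k, |(2 * k + 1) * oext f j - t * j|, ?_⟩
  intro b hb
  obtain ⟨a, j, h1, h2, h, h3⟩ := hb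
  have h4 : (2 * (k:ℤ) + 1) * a ≤ (2 * k + 1) * oext f j :=
    mul_le_mul_of_nonneg_left h3 (by omega)
  have h5 := Finset.single_le_sum (f := fun j : ℤ => |(2 * k + 1) * oext f j - t * j|)
    (fun i _ => abs_nonneg _) (Finset.mem_Icc.2 ⟨h1, h2⟩)
  have h6 := le_abs_self ((2 * k + 1) * oext f j - t * j)
  linarith [Int.natCast_nonneg k]

lemma SS_inj (k t h : ℕ) (hc : Nat.Coprime (2 * k + 1) t) (f g : ℕ → ℕ) (hf : f ∈ QQ k h)
    (hg : g ∈ QQ k h) (e : SS k t f = SS k t g) : f = g := by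
  rw [mem_QQ] at hf hg
  funext j
  by_cases hj : j ≤ k
  · have key : ∀ a : ℤ, a ≤ f j ↔ a ≤ g j := by
      intro a
      rw [← oext_nat f hf.1, ← oext_nat g hg.1]
      rw [← mem_SS k t hc f a j (by omega) (by omega) ((2 * k + 1) * a - t * j - k) (by ring),
        ← mem_SS k t hc g a j (by omega) (by omega) ((2 * k + 1) * a - t * j - k) (by ring), e]
    have h1 := (key (f j)).1 le_rfl
    have h2 := (key (g j)).2 le_rfl
    omega
  · rw [hf.2.2.2 j (by omega), hg.2.2.2 j (by omega)]

lemma SS_surj (k t : ℕ) (hc : Nat.Coprime (2 * k + 1) t) (S : Set ℤ)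
    (hb : ∃ N : ℤ, ∀ b ∈ S, b ≤ N) (hS : ∀ b, b ∈ S ↔ 1 - b ∉ S)
    (hs : ∀ b ∈ S, b - (2 * k + 1 : ℕ) ∈ S) (ht : ∀ b ∈ S, b - t ∈ S) :
    ∃ f ∈ QQ k (t / 2), S = SS k t f := by
  obtain ⟨N, hN⟩ := hb
  have hD : ∀ j : ℤ, ∃ d : ℤ, ∀ a : ℤ, (2 * k + 1) * a - t * j - k ∈ S ↔ a ≤ d := by
    intro j
    have hbdd : ∃ B : ℤ, ∀ a : ℤ, (2 * k + 1) * a - t * j - k ∈ S → a ≤ B := by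
      refine ⟨|N + t * j + k|, fun a ha => ?_⟩
      have h1 := hN _ ha
      have h2 := le_abs_self (N + t * j + k)
      by_contra hlt
      push Not at hlt
      nlinarith [abs_nonneg (N + t * j + k), Int.natCast_nonneg k]
    have hne : ∃ a : ℤ, (2 * k + 1) * a - t * j - k ∈ S := by
      refine ⟨-|N - t * j|, ?_⟩
      rw [hS]
      intro hmem
      have h1 := hN _ hmem
      have h2 := le_abs_self (N - t * j)
      nlinarith [abs_nonneg (N - t * j), Int.natCast_nonneg k,
        mul_nonneg (Int.natCast_nonneg k) (abs_nonneg (N - t * j))]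
    obtain ⟨d, hd, hmax⟩ := Int.exists_greatest_of_bdd hbdd hne
    refine ⟨d, fun a => ⟨hmax a, fun had => ?_⟩⟩
    have hdown : ∀ n : ℕ, (2 * k + 1) * (d - n) - t * j - k ∈ S := by
      intro n
      induction n with
      | zero => simpa using hd
      | succ n ih =>
        have := hs _ ih
        convert this using 1
        push_cast; ring
    obtain ⟨n, hn⟩ := Int.le.dest had
    have := hdown n
    rwa [show d - n = a by omega] at this
  choose D hD using hD
  have hodd : ∀ j, D (-j) = - D j := by
    intro j
    have key : ∀ a : ℤ, a ≤ D j ↔ ¬ (1 - a ≤ D (-j)) := by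
      intro a
      rw [← hD, ← hD, hS]
      rw [show 1 - ((2 * (k:ℤ) + 1) * a - t * j - k) = (2 * k + 1) * (1 - a) - t * -j - k by ring]
    have h1 := (key (D j)).1 le_rfl
    have h2 := (key (D j + 1)).not.1 (by omega)
    omega
  have hmono : ∀ j, D j ≤ D (j + 1) := by
    intro j
    rw [← hD]
    have := ht _ ((hD j _).2 le_rfl)
    convert this using 1
    ring
  have hper : ∀ j, D (j + (2 * k + 1)) = D j + t := by
    intro j
    have key : ∀ a : ℤ, a ≤ D (j + (2 * k + 1)) ↔ a - t ≤ D j := by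
      intro a
      rw [← hD, ← hD]
      rw [show (2 * (k:ℤ) + 1) * a - t * (j + (2 * k + 1)) - k
        = (2 * k + 1) * (a - t) - t * j - k by ring]
    have h1 := (key (D (j + (2 * k + 1)))).1 le_rfl
    have h2 := (key (D j + t)).2 (by omega)
    omega
  have hD0 : D 0 = 0 := by
    have := hodd 0
    simp only [neg_zero] at this
    omega
  have hnn : ∀ n : ℕ, 0 ≤ D n := by
    intro n
    induction n with
    | zero => simp [hD0]
    | succ n ih => push_cast; exact ih.trans (hmono n)
  have hk : 2 * D k ≤ t := by
    have h1 := hper (-k)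
    have h2 := hmono k
    rw [hodd, show (-(k:ℤ) + (2 * k + 1)) = k + 1 by ring] at h1
    omega
  let f : ℕ → ℕ := fun j => if j ≤ k then (D j).toNat else 0
  have hfj : ∀ j : ℕ, j ≤ k → (f j : ℤ) = D j := by
    intro j hj
    have := hnn j
    simp only [f, if_pos hj]
    omega
  have hf0 : f 0 = 0 := by
    have := hfj 0 (Nat.zero_le _)
    rw [Nat.cast_zero, hD0] at this
    exact_mod_cast this
  have hfo : ∀ j : ℤ, -(k:ℤ) ≤ j → j ≤ k → oext f j = D j := by
    intro j h1 h2
    obtain ⟨n, rfl | rfl⟩ := j.eq_nat_or_neg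
    · rw [oext_nat f hf0, hfj n (by omega)]
    · rw [oext_neg, oext_nat f hf0, hfj n (by omega), hodd]
  refine ⟨f, ?_, ?_⟩
  · rw [mem_QQ]
    refine ⟨hf0, ?_, ?_, ?_⟩
    · intro j hj
      have h1 := hfj j (by omega)
      have h2 := hfj (j+1) (by omega)
      have h3 := hmono j
      push_cast at h2
      omega
    · have h1 := hfj k le_rfl
      omega
    · intro j hj
      simp only [f, if_neg (not_le.2 hj)]
  · ext b
    obtain ⟨a, j, h1, h2, h⟩ := rep_exists k t hc (b + k)
    rw [mem_SS k t hc f a j h1 h2 b h, hfo j h1 h2, ← hD]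
    rw [← h, add_sub_cancel_right]

lemma sum_Icc_symm (k : ℕ) (F : ℤ → ℤ) :
    ∑ j ∈ Finset.Icc (-(k:ℤ)) k, F j = ∑ j ∈ Finset.range (k + 1), (F j + F (-j)) - F 0 := by
  induction k with
  | zero => simp
  | succ k ih =>
    have : Finset.Icc (-((k+1:ℕ):ℤ)) ((k+1:ℕ):ℤ)
        = insert (-((k:ℤ)+1)) (insert ((k:ℤ)+1) (Finset.Icc (-(k:ℤ)) k)) := by
      ext x
      simp only [Finset.mem_Icc, Finset.mem_insert]
      push_cast
      omega
    rw [this, Finset.sum_insert, Finset.sum_insert, ih, Finset.sum_range_succ _ (k+1)]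
    · push_cast; ring
    · simp
    · simp only [Finset.mem_insert, Finset.mem_Icc]; omega

lemma size_of_SS (k t h : ℕ) (hc : Nat.Coprime (2 * k + 1) t) (f : ℕ → ℕ) (hf : f ∈ QQ k h)
    (p : YPartition) (hp : p.bset = SS k t f) :
    6 * (2 * (k:ℤ) + 1) * p.size =
      6 * ∑ j ∈ Finset.range (k + 1), ((2 * k + 1) * (f j : ℤ) - t * j)^2
        - k * (k + 1) * (2 * k + 1) := by
  classical
  have hf0 : f 0 = 0 := ((mem_QQ _ _ _).1 hf).1
  have hinj : Set.InjOn (fun j : ℤ => (2 * k + 1) * oext f j - t * j - k)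
      (Finset.Icc (-(k:ℤ)) k : Finset ℤ) := by
    intro j hj j' hj' e
    rw [Finset.mem_coe, Finset.mem_Icc] at hj hj'
    simp only at e
    exact (rep_unique k t hc (oext f j) j (oext f j') j' hj.1 hj.2 hj'.1 hj'.2 (by linear_combination e)).2
  have main := YPartition.size_tops p (2 * k + 1)
    ((Finset.Icc (-(k:ℤ)) k).image fun j => (2 * k + 1) * oext f j - t * j - k)
    (by omega) (by rw [hp]; exact SS_s k t hc f) (by
      intro b
      rw [hp]
      obtain ⟨a, j, h1, h2, h⟩ := rep_exists k t hc (b + k)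
      rw [mem_SS k t hc f a j h1 h2 b h, mem_SS k t hc f (a + 1) j h1 h2 (b + (2 * k + 1 : ℕ))
        (by push_cast; linear_combination h)]
      simp only [Finset.mem_image, Finset.mem_Icc]
      constructor
      · rintro ⟨j', ⟨h1', h2'⟩, e⟩
        obtain ⟨rfl, rfl⟩ := rep_unique k t hc a j (oext f j') j' h1 h2 h1' h2'
          (by linear_combination -h - e)
        omega
      · intro hh
        refine ⟨j, ⟨h1, h2⟩, ?_⟩
        have : oext f j = a := by omega
        rw [this, ← h]; ring)
  rw [Finset.sum_image hinj, sum_Icc_symm] at main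
  have e : ∀ j ∈ Finset.range (k + 1),
      ((2 * k + 1) * oext f (j:ℤ) - t * (j:ℤ) - k) *
        ((2 * k + 1) * oext f (j:ℤ) - t * (j:ℤ) - k + ((2 * k + 1 : ℕ) : ℤ)) +
      ((2 * k + 1) * oext f (-(j:ℤ)) - t * (-(j:ℤ)) - k) *
        ((2 * k + 1) * oext f (-(j:ℤ)) - t * (-(j:ℤ)) - k + ((2 * k + 1 : ℕ) : ℤ))
      = 2 * ((2 * k + 1) * (f j : ℤ) - t * j)^2 - 2 * (k * (k + 1)) := by
    intro j _
    rw [oext_neg, oext_nat f hf0]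
    push_cast; ring
  rw [Finset.sum_congr rfl e, Finset.sum_sub_distrib, ← Finset.mul_sum] at main
  simp only [Finset.sum_const, Finset.card_range, oext, Int.sign_zero] at main
  push_cast at main
  simp only [nsmul_eq_mul] at main
  push_cast at main
  linarith

open YPartition in
lemma main_odd (k t : ℕ) (ht : 0 < t) (hc : Nat.Coprime (2 * k + 1) t) :
    {p : YPartition | p.SelfConj ∧ IsCore (2 * k + 1) p ∧ IsCore t p}.Finite ∧
    24 * (∑ᶠ p ∈ {p : YPartition | p.SelfConj ∧ IsCore (2 * k + 1) p ∧ IsCore t p}, p.size) =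
      (2 * k + 1 + t + 1) * (2 * k) * (t - 1) * Nat.choose (k + t / 2) k := by
  classical
  have hex : ∀ f : ℕ → ℕ, ∃ p : YPartition, p.SelfConj ∧ p.bset = SS k t f := fun f =>
    exists_of_symm _ (SS_bdd k t f) (SS_symm k t hc f)
  choose P hP1 hP2 using hex
  have hset : {p : YPartition | p.SelfConj ∧ IsCore (2 * k + 1) p ∧ IsCore t p}
      = (((QQ k (t / 2)).image P : Finset YPartition) : Set YPartition) := by
    ext p
    simp only [Set.mem_ofPred_eq, Finset.coe_image, Set.mem_image, Finset.mem_coe]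
    constructor
    · rintro ⟨h1, h2, h3⟩
      obtain ⟨f, hf, e⟩ := SS_surj k t hc p.bset (bdd_b p) (symm_b h1)
        ((core_iff h1 _).1 h2) ((core_iff h1 _).1 h3)
      exact ⟨f, hf, bset_inj (by rw [hP2, e])⟩
    · rintro ⟨f, hf, rfl⟩
      refine ⟨hP1 f, ?_, ?_⟩
      · rw [core_iff (hP1 f), hP2]
        exact SS_s k t hc f
      · rw [core_iff (hP1 f), hP2]
        exact SS_t k t hc f hf
  rw [hset]
  refine ⟨Finset.finite_toSet _, ?_⟩
  rw [finsum_mem_coe_finset, Finset.sum_image (by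
    intro f hf g hg e
    apply SS_inj k t _ hc f g hf hg
    rw [← hP2, ← hP2, e])]
  have h1 : 6 * (2 * (k:ℤ) + 1) * ∑ f ∈ QQ k (t / 2), ((P f).size : ℤ)
      = 6 * ∑ f ∈ QQ k (t / 2), ∑ j ∈ Finset.range (k + 1), ((2 * k + 1) * (f j : ℤ) - t * j)^2
        - k * (k + 1) * (2 * k + 1) * ∑ f ∈ QQ k (t / 2), (1:ℤ) := by
    rw [Finset.mul_sum, Finset.mul_sum, Finset.mul_sum, ← Finset.sum_sub_distrib]
    apply Finset.sum_congr rfl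
    intro f hf
    rw [size_of_SS k t _ hc f hf (P f) (hP2 f)]
    ring
  rw [QQ_sum, QQ_card] at h1
  have hpos : (2 * (k:ℤ) + 1) ≠ 0 := by omega
  obtain ⟨t', rfl⟩ : ∃ t', t = t' + 1 := ⟨t - 1, by omega⟩
  rw [Nat.add_sub_cancel]
  zify
  apply mul_left_cancel₀ hpos
  generalize (∑ f ∈ QQ k ((t' + 1) / 2), ((P f).size : ℤ)) = Z at *
  generalize (k + (t' + 1) / 2).choose k = C at *
  rcases Nat.even_or_odd' (t' + 1) with ⟨h, e | e⟩
  · rw [show (t' + 1) / 2 = h by omega] at h1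
    have e' : (t' : ℤ) = 2 * h - 1 := by omega
    push_cast at h1 ⊢
    rw [e'] at h1 ⊢
    linear_combination 4 * h1
  · rw [show (t' + 1) / 2 = h by omega] at h1
    have e' : (t' : ℤ) = 2 * h := by omega
    push_cast at h1 ⊢
    rw [e'] at h1 ⊢
    linear_combination 4 * h1

open YPartition in
/-- The average size of a self-conjugate `(s,t)`-core partition is
`(s+t+1)(s-1)(t-1)/24`: the set of self-conjugate `(s,t)`-cores is finite and
`24` times the sum of their sizes is `(s+t+1)(s-1)(t-1) * C(⌊s/2⌋+⌊t/2⌋, ⌊s/2⌋)`. -/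
theorem average_size_selfconjugate_core (s t : ℕ) (hs : 0 < s) (ht : 0 < t)
    (hst : Nat.Coprime s t) :
    {p : YPartition | p.SelfConj ∧ IsCore s p ∧ IsCore t p}.Finite ∧
    24 * (∑ᶠ p ∈ {p : YPartition | p.SelfConj ∧ IsCore s p ∧ IsCore t p}, p.size) =
      (s + t + 1) * (s - 1) * (t - 1) * Nat.choose (s / 2 + t / 2) (s / 2) := by
  rcases Nat.even_or_odd' s with ⟨k, e | e⟩
  · rcases Nat.even_or_odd' t with ⟨m, e' | e'⟩
    · exfalso
      subst e e'
      have := Nat.Coprime.eq_one_of_dvd (hst.coprime_dvd_left (Dvd.intro k rfl)) (Dvd.intro m rfl)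
      omega
    · subst e'
      have := main_odd m s hs hst.symm
      rw [show (2 * m + 1) / 2 = m by omega, show 2 * m + 1 - 1 = 2 * m by omega]
      rw [show {p : YPartition | p.SelfConj ∧ IsCore s p ∧ IsCore (2 * m + 1) p}
        = {p : YPartition | p.SelfConj ∧ IsCore (2 * m + 1) p ∧ IsCore s p} by
          ext p; simp only [Set.mem_ofPred_eq]; tauto]
      refine ⟨this.1, ?_⟩
      rw [this.2, Nat.choose_symm_add, Nat.add_comm m]
      ring
  · subst e
    have := main_odd k t ht hst
    rw [show (2 * k + 1) / 2 = k by omega, show 2 * k + 1 - 1 = 2 * k by omega]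
    exact this
end

section
/- Let s and t be coprime positive integers. Then the set of (s,t)-core partitions is finite and has cardinality C(s+t, s)/(s+t). -/
/-- The (shifted) first-column hook data of a partition. -/
noncomputable def bet (p : YPartition) (i : ℕ) : ℤ := (p.parts i : ℤ) - i

/-- The Maya diagram of a partition. -/
def maya (p : YPartition) : Set ℤ := Set.range (bet p)

lemma bet_lt (p : YPartition) {i j : ℕ} (h : i < j) : bet p j < bet p i := by
  have := p.antitone h.le
  unfold bet; omega

lemma conj_eq (p : YPartition) (j c : ℕ) (h1 : ∀ i < c, j < p.parts i) (h2 : p.parts c ≤ j) :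
    p.conj j = c := by
  have : {i : ℕ | j < p.parts i} = ↑(Finset.range c) := by
    ext i
    simp only [Set.mem_ofPred_eq, Finset.coe_range, Set.mem_Iio]
    constructor
    · intro h
      by_contra hc
      have := p.antitone (not_lt.mp hc)
      omega
    · exact h1 i
  unfold YPartition.conj
  rw [this, Set.ncard_coe_finset, Finset.card_range]

lemma exists_col (p : YPartition) (j : ℕ) :
    ∃ c, (∀ i < c, j < p.parts i) ∧ p.parts c ≤ j := by
  have hex : ∃ c, p.parts c ≤ j := by
    obtain ⟨N, hN⟩ := p.finite_support
    exact ⟨N, by rw [hN N le_rfl]; omega⟩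
  classical
  refine ⟨Nat.find hex, fun i hi => ?_, Nat.find_spec hex⟩
  have := Nat.find_min hex hi
  omega

lemma core_iff (p : YPartition) (t : ℕ) (ht : 0 < t) :
    p.IsCore t ↔ ∀ x ∈ maya p, x - t ∈ maya p := by
  constructor
  · rintro h x ⟨i, rfl⟩
    by_contra hy
    have hex : ∃ c, bet p c < bet p i - t := by
      obtain ⟨N, hN⟩ := p.finite_support
      refine ⟨N + t + i + 1, ?_⟩
      unfold bet
      rw [hN (N + t + i + 1) (by omega)]
      push_cast; omega
    classical
    obtain ⟨c, hc1, hc2⟩ : ∃ c, bet p c < bet p i - t ∧ ∀ m < c, ¬ bet p m < bet p i - t :=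
      ⟨Nat.find hex, Nat.find_spec hex, fun m hm => Nat.find_min hex hm⟩
    have hic : i < c := by
      by_contra hcon
      rcases (not_lt.mp hcon).lt_or_eq with h' | h'
      · have := bet_lt p h'; omega
      · subst h'; omega
    obtain ⟨d, rfl⟩ : ∃ d, c = d + 1 := ⟨c - 1, by omega⟩
    have h3 := hc2 d (by omega)
    have h4 : bet p d ≠ bet p i - t := fun he => hy ⟨d, he⟩
    have h5 : 0 ≤ bet p i - t + d := by
      unfold bet at *; push_cast at *; omega
    obtain ⟨j, hj⟩ := Int.eq_ofNat_of_zero_le h5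
    have hd : j < p.parts d := by unfold bet at *; push_cast at *; omega
    have hd1 : p.parts (d+1) ≤ j := by unfold bet at *; push_cast at *; omega
    have hco := conj_eq p j (d+1) (fun m hm => lt_of_lt_of_le hd (p.antitone (by omega))) hd1
    have hij : j < p.parts i := lt_of_lt_of_le hd (p.antitone (by omega))
    refine h i j hij ?_
    unfold YPartition.hook
    rw [hco]
    unfold bet at *; push_cast at *; omega
  · intro h i j hij hh
    have hij' : j < p.parts i := hij
    obtain ⟨c, hc1, hc2⟩ := exists_col p j
    have hco := conj_eq p j c hc1 hc2
    unfold YPartition.hook at hh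
    rw [hco] at hh
    have hic : i < c := by
      by_contra hcon
      have := p.antitone (not_lt.mp hcon)
      omega
    obtain ⟨m, hm⟩ := h _ ⟨i, rfl⟩
    rcases lt_or_ge m c with hmc | hmc
    · have := hc1 m hmc
      unfold bet at hm; omega
    · have := p.antitone hmc
      unfold bet at hm; omega

lemma maya_shift (p q : YPartition) (d : ℤ) (h : ∀ x, x ∈ maya p ↔ x + d ∈ maya q) :
    p = q ∧ d = 0 := by
  have h1 : (fun i => -(bet p i + d)) = fun i => -(bet q i) := by
    refine (StrictMono.range_inj ?_ ?_).mp ?_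
    · intro i j hij
      have := bet_lt p hij
      simp only; omega
    · intro i j hij
      have := bet_lt q hij
      simp only; omega
    · ext y
      constructor
      · rintro ⟨i, rfl⟩
        obtain ⟨k, hk⟩ := (h (bet p i)).mp ⟨i, rfl⟩
        exact ⟨k, by simp only; omega⟩
      · rintro ⟨i, rfl⟩
        obtain ⟨k, hk⟩ := (h (bet q i - d)).mpr ⟨i, by ring⟩
        exact ⟨k, by simp only; omega⟩
  have h2 : ∀ i, bet p i + d = bet q i := fun i => by
    have := congrFun h1 i
    omega
  have hd : d = 0 := by
    obtain ⟨N, hN⟩ := p.finite_support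
    obtain ⟨N', hN'⟩ := q.finite_support
    have := h2 (N + N')
    unfold bet at this
    rw [hN _ (by omega), hN' _ (by omega)] at this
    omega
  refine ⟨?_, hd⟩
  have h3 : p.parts = q.parts := by
    funext i
    have := h2 i
    unfold bet at this; omega
  cases p; cases q; simp only at h3; subst h3; rfl

lemma exists_partition (M : Set ℤ) (B L : ℤ) (hB : ∀ x ∈ M, x ≤ B) (hL : ∀ x ≤ L, x ∈ M) :
    ∃ (p : YPartition) (c : ℤ), ∀ x, x ∈ maya p ↔ x + c ∈ M := by
  classical
  let P : ℕ → Prop := fun k => B - k ∈ M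
  let K : ℕ := (B - L).toNat
  have hK : ∀ k, K ≤ k → P k := fun k hk => hL _ (by omega)
  have hinf : (Set.ofPred P).Infinite := by
    refine Set.infinite_of_not_bddAbove ?_
    rintro ⟨b, hb⟩
    have := hb (show b + K + 1 ∈ Set.ofPred P from hK _ (by omega))
    omega
  have hcount : ∀ j, Nat.count P (K + j) = Nat.count P K + j := by
    intro j
    induction j with
    | zero => rfl
    | succ j ih =>
      rw [← add_assoc, Nat.count_succ, ih, if_pos (hK _ (by omega))]; omega
  have hnth : ∀ j, Nat.nth P (Nat.count P K + j) = K + j := by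
    intro j
    rw [← hcount, Nat.nth_count (hK _ (by omega))]
  have hle : Nat.count P K ≤ K := Nat.count_le _
  have hsm := Nat.nth_strictMono hinf
  have hmono : ∀ i j, Nat.nth P i + j ≤ Nat.nth P (i + j) := by
    intro i j
    induction j with
    | zero => simp
    | succ j ih =>
      have := hsm (show i + j < i + (j + 1) by omega)
      omega
  have hub : ∀ i, Nat.nth P i ≤ (K - Nat.count P K) + i := by
    intro i
    have h1 := hmono i (Nat.count P K)
    have h2 := hnth i
    rw [add_comm i] at h1
    omega
  refine ⟨⟨fun i => (K - Nat.count P K) + i - Nat.nth P i, ?_, ?_⟩, B - (K - Nat.count P K : ℕ), ?_⟩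
  · intro i j hij
    obtain ⟨k, rfl⟩ := Nat.exists_eq_add_of_le hij
    have := hmono i k
    omega
  · refine ⟨Nat.count P K, fun i hi => ?_⟩
    obtain ⟨k, rfl⟩ := Nat.exists_eq_add_of_le hi
    have := hnth k
    omega
  · intro x
    constructor
    · rintro ⟨i, rfl⟩
      have h1 : P (Nat.nth P i) := Nat.nth_mem_of_infinite hinf i
      have h2 := hub i
      have h3 : B - (Nat.nth P i : ℤ) ∈ M := h1
      convert h3 using 1
      simp only [bet]
      omega
    · intro hx
      have h0 := hB _ hx
      obtain ⟨k, hk⟩ := Int.eq_ofNat_of_zero_le (show 0 ≤ (K - Nat.count P K : ℕ) - x by omega)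
      have hPk : P k := by
        show B - (k : ℤ) ∈ M
        convert hx using 1
        omega
      refine ⟨Nat.count P k, ?_⟩
      have h1 := Nat.nth_count hPk
      have h2 := hub (Nat.count P k)
      simp only [bet]
      omega

/-- Sets of integers bounded above, containing all small integers, closed under -s, -t. -/
structure Good (s t : ℕ) (M : Set ℤ) : Prop where
  cs : ∀ x ∈ M, x - s ∈ M
  ct : ∀ x ∈ M, x - t ∈ M
  bd : ∃ B, ∀ x ∈ M, x ≤ B
  low : ∃ L, ∀ x ≤ L, x ∈ M

lemma good_maya (s t : ℕ) (hs : 0 < s) (ht : 0 < t) (p : YPartition)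
    (h1 : p.IsCore s) (h2 : p.IsCore t) : Good s t (maya p) := by
  refine ⟨(core_iff p s hs).mp h1, (core_iff p t ht).mp h2, ⟨p.parts 0, ?_⟩, ?_⟩
  · rintro x ⟨i, rfl⟩
    have := p.antitone (Nat.zero_le i)
    unfold bet; omega
  · obtain ⟨N, hN⟩ := p.finite_support
    refine ⟨-N, fun x hx => ⟨(-x).toNat, ?_⟩⟩
    unfold bet
    rw [hN _ (by omega)]; omega

/-- boundary elements -/
def Bdry (s t : ℕ) (M : Set ℤ) : Set ℤ := {x | x ∈ M ∧ x + (s + t) ∉ M}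

lemma Good.cn {s t : ℕ} {M : Set ℤ} (h : Good s t M) (j : ℕ) :
    ∀ x ∈ M, x - (s + t) * j ∈ M := by
  induction j with
  | zero => intro x hx; simpa using hx
  | succ j ih =>
    intro x hx
    have := h.cs _ (h.ct _ (ih x hx))
    convert this using 1
    push_cast; ring

lemma bdry_le {s t : ℕ} (hs : 0 < s) {M : Set ℤ} (h : Good s t M) {x y : ℤ} (hx : x ∈ Bdry s t M)
    (hy : y ∈ M) (hd : ((s : ℤ) + t) ∣ y - x) : y ≤ x := by
  obtain ⟨j, hj⟩ := hd
  by_contra hlt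
  have hj0 : 0 < j := by
    by_contra hc
    have : ((s : ℤ) + t) * j ≤ 0 := mul_nonpos_of_nonneg_of_nonpos (by positivity) (by omega)
    omega
  obtain ⟨k, hk⟩ := Int.eq_ofNat_of_zero_le (show 0 ≤ j - 1 by omega)
  have := h.cn k y hy
  apply hx.2
  convert this using 1
  have : j = k + 1 := by omega
  subst this
  linear_combination -hj

lemma bdry_unique {s t : ℕ} (hs : 0 < s) {M : Set ℤ} (h : Good s t M) {x y : ℤ}
    (hx : x ∈ Bdry s t M) (hy : y ∈ Bdry s t M) (hd : ((s : ℤ) + t) ∣ y - x) : y = x :=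
  le_antisymm (bdry_le hs h hx hy.1 hd)
    (bdry_le hs h hy hx.1 (by rw [← neg_sub]; exact (dvd_neg).mpr hd))

lemma bdry_exists {s t : ℕ} (hs : 0 < s) {M : Set ℤ} (h : Good s t M) (r : ℤ) :
    ∃ a ∈ Bdry s t M, ((s : ℤ) + t) ∣ a - r := by
  obtain ⟨B, hB⟩ := h.bd
  obtain ⟨L, hL⟩ := h.low
  obtain ⟨z, hz1, hz2⟩ := Int.exists_greatest_of_bdd (P := fun z => r + (s + t) * z ∈ M)
    ⟨max (B - r) 0, fun z hz => by
      have := hB _ hz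
      by_contra hc
      have h1 : 0 < z := by omega
      have : z ≤ ((s:ℤ) + t) * z := by nlinarith
      omega⟩
    ⟨min (L - r) 0, hL _ (by
      have h1 : min (L - r) 0 ≤ 0 := min_le_right _ _
      have h2 : min (L - r) 0 ≤ L - r := min_le_left _ _
      have : ((s:ℤ) + t) * min (L - r) 0 ≤ min (L - r) 0 := by nlinarith
      omega)⟩
  refine ⟨r + (s + t) * z, ⟨hz1, fun hc => ?_⟩, ⟨z, by ring⟩⟩
  have := hz2 (z + 1) (by convert hc using 1; ring)
  omega

open Classical in
/-- The boundary walk. -/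
noncomputable def walk (s t : ℕ) (M : Set ℤ) (a : ℤ) : ℕ → ℤ
  | 0 => a
  | k + 1 => if walk s t M a k + s ∈ M then walk s t M a k + s else walk s t M a k - t

open Classical in
/-- The set of up steps. -/
noncomputable def ups (s t : ℕ) (M : Set ℤ) (a : ℤ) (n : ℕ) : Finset ℕ :=
  (Finset.range n).filter (fun k => walk s t M a k + s ∈ M)

lemma walk_mem {s t : ℕ} {M : Set ℤ} (h : Good s t M) {a : ℤ} (ha : a ∈ Bdry s t M) (k : ℕ) :
    walk s t M a k ∈ Bdry s t M := by
  induction k with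
  | zero => exact ha
  | succ k ih =>
    rw [walk]
    split_ifs with hc
    · refine ⟨hc, fun hc2 => ih.2 ?_⟩
      have := h.cs _ hc2
      convert this using 1; ring
    · refine ⟨h.ct _ ih.1, fun hc2 => hc ?_⟩
      convert hc2 using 1; ring

/-- Explicit walk associated with a set of up steps. -/
def wk (s t : ℕ) (U : Finset ℕ) (k : ℕ) : ℤ :=
  (s + t) * ((U.filter (· < k)).card : ℤ) - t * k

lemma wk_succ (s t : ℕ) (U : Finset ℕ) (k : ℕ) :
    wk s t U (k + 1) = if k ∈ U then wk s t U k + s else wk s t U k - t := by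
  unfold wk
  split_ifs with h
  · have : U.filter (· < k + 1) = insert k (U.filter (· < k)) := by
      ext x; simp only [Finset.mem_filter, Finset.mem_insert]
      constructor
      · rintro ⟨h1, h2⟩
        rcases Nat.lt_succ_iff_lt_or_eq.mp h2 with h3 | h3
        · exact Or.inr ⟨h1, h3⟩
        · exact Or.inl h3
      · rintro (rfl | ⟨h1, h2⟩)
        · exact ⟨h, by omega⟩
        · exact ⟨h1, by omega⟩
    rw [this, Finset.card_insert_of_notMem (by simp)]
    push_cast; ring
  · have : U.filter (· < k + 1) = U.filter (· < k) := by
      ext x; simp only [Finset.mem_filter]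
      constructor
      · rintro ⟨h1, h2⟩
        rcases Nat.lt_succ_iff_lt_or_eq.mp h2 with h3 | h3
        · exact ⟨h1, h3⟩
        · exact absurd (h3 ▸ h1) h
      · rintro ⟨h1, h2⟩
        exact ⟨h1, by omega⟩
    rw [this]
    push_cast; ring

lemma wk_zero (s t : ℕ) (U : Finset ℕ) : wk s t U 0 = 0 := by simp [wk]

lemma walk_eq_wk (s t : ℕ) (M : Set ℤ) (a : ℤ) (n k : ℕ) (hk : k ≤ n) :
    walk s t M a k = a + wk s t (ups s t M a n) k := by
  induction k with
  | zero => simp [walk, wk_zero]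
  | succ k ih =>
    have ih := ih (by omega)
    have hm : k ∈ ups s t M a n ↔ walk s t M a k + s ∈ M := by
      simp only [ups, Finset.mem_filter, Finset.mem_range]
      exact ⟨fun h => h.2, fun h => ⟨by omega, h⟩⟩
    rw [walk, wk_succ]
    simp only [← hm]
    split_ifs <;> rw [ih] <;> ring

lemma filter_full {n : ℕ} {U : Finset ℕ} (hU : U ⊆ Finset.range n) : U.filter (· < n) = U := by
  apply Finset.filter_true_of_mem
  intro x hx
  exact Finset.mem_range.mp (hU hx)

lemma ups_card {s t : ℕ} (hs : 0 < s) {M : Set ℤ} (h : Good s t M) {a : ℤ}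
    (ha : a ∈ Bdry s t M) : (ups s t M a (s + t)).card = t := by
  have h1 := walk_eq_wk s t M a (s + t) (s + t) le_rfl
  have hsub : ups s t M a (s + t) ⊆ Finset.range (s + t) := by
    classical
    exact Finset.filter_subset _ _
  have h2 : walk s t M a (s + t) = a := by
    refine bdry_unique hs h ha (walk_mem h ha _) ?_
    rw [h1]
    unfold wk
    refine ⟨((ups s t M a (s + t)).filter (· < s + t)).card - t, ?_⟩
    push_cast; ring
  rw [h2] at h1
  unfold wk at h1
  rw [filter_full hsub] at h1
  have h3 : ((s : ℤ) + t) * ((ups s t M a (s + t)).card - t) = 0 := by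
    push_cast at h1; linear_combination -h1
  rcases mul_eq_zero.mp h3 with h4 | h4 <;> omega

lemma wk_surj {s t : ℕ} (hs : 0 < s) (hst : Nat.Coprime s t) (U : Finset ℕ) (x : ℤ) :
    ∃ k < s + t, ((s : ℤ) + t) ∣ wk s t U k - x := by
  have hc : IsCoprime (t : ℤ) ((s : ℤ) + t) := by
    have : Nat.Coprime t (s + t) := by simpa using hst.symm
    have := Nat.isCoprime_iff_coprime.mpr this
    simpa using this
  obtain ⟨u, v, huv⟩ := hc
  have hn : (0 : ℤ) < s + t := by positivity
  have h0 := Int.emod_nonneg (-x * u) hn.ne'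
  have h1 := Int.emod_lt_of_pos (-x * u) hn
  obtain ⟨k, hk⟩ := Int.eq_ofNat_of_zero_le h0
  refine ⟨k, by omega, ?_⟩
  have hd := Int.mul_ediv_add_emod (-x * u) (s + t)
  rw [hk] at hd
  unfold wk
  refine ⟨((U.filter (· < k)).card : ℤ) + t * ((-x * u) / (s + t)) - x * v, ?_⟩
  have : (k : ℤ) = -x * u - (s + t) * ((-x * u) / (s + t)) := by
    try simp only [Int.ofNat_eq_natCast] at hd
    linear_combination hd
  rw [this]
  linear_combination x * huv

lemma wk_inj {s t : ℕ} (hst : Nat.Coprime s t) (U : Finset ℕ) {k l : ℕ}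
    (hk : k < s + t) (hl : l < s + t) (h : ((s : ℤ) + t) ∣ wk s t U k - wk s t U l) : k = l := by
  have hc : IsCoprime ((s : ℤ) + t) (t : ℤ) := by
    have : Nat.Coprime (s + t) t := by simpa using hst
    have := Nat.isCoprime_iff_coprime.mpr this
    simpa using this
  obtain ⟨e, he⟩ := h
  have h1 : ((s : ℤ) + t) ∣ t * ((k : ℤ) - l) := by
    unfold wk at he
    refine ⟨((U.filter (· < k)).card : ℤ) - ((U.filter (· < l)).card : ℤ) - e, ?_⟩
    linear_combination -he
  have h2 := hc.dvd_of_dvd_mul_left h1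
  have h3 : (k : ℤ) - l = 0 := Int.eq_zero_of_abs_lt_dvd h2 (by rw [abs_lt]; omega)
  omega

lemma mem_iff_walk {s t : ℕ} (hs : 0 < s) (hst : Nat.Coprime s t) {M : Set ℤ} (h : Good s t M)
    {a : ℤ} (ha : a ∈ Bdry s t M) (x : ℤ) :
    x ∈ M ↔ ∃ k < s + t, ∃ j : ℕ, x = a + wk s t (ups s t M a (s + t)) k - (s + t) * j := by
  constructor
  · intro hx
    obtain ⟨k, hk, hd⟩ := wk_surj hs hst (ups s t M a (s + t)) (x - a)
    have hw := walk_eq_wk s t M a (s + t) k hk.le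
    have hd' : ((s : ℤ) + t) ∣ walk s t M a k - x := by
      rw [hw]; convert hd using 1; ring
    have hle := bdry_le hs h (walk_mem h ha k) hx
      (by rw [← neg_sub]; exact (dvd_neg).mpr hd')
    obtain ⟨j, hj⟩ := hd'
    have hj0 : 0 ≤ j := by
      by_contra hc
      have : ((s:ℤ) + t) * j < 0 := mul_neg_of_pos_of_neg (by positivity) (by omega)
      omega
    obtain ⟨j', rfl⟩ := Int.eq_ofNat_of_zero_le hj0
    refine ⟨k, hk, j', ?_⟩
    rw [← hw]
    try simp only [Int.ofNat_eq_natCast] at hj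
    linear_combination -hj
  · rintro ⟨k, hk, j, rfl⟩
    rw [← walk_eq_wk s t M a (s + t) k hk.le]
    exact h.cn j _ (walk_mem h ha k).1

/-- The set of integers built from a word. -/
def MU (s t : ℕ) (U : Finset ℕ) : Set ℤ :=
  {x | ∃ k < s + t, ∃ j : ℕ, x = wk s t U k - (s + t) * j}

lemma wk_n {s t : ℕ} {U : Finset ℕ} (hU : U ⊆ Finset.range (s + t)) (hc : U.card = t) :
    wk s t U (s + t) = 0 := by
  unfold wk
  rw [filter_full hU, hc]; push_cast; ring

lemma MU_mem' {s t : ℕ} (hs : 0 < s) {U : Finset ℕ} (hU : U ⊆ Finset.range (s + t))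
    (hc : U.card = t) {k : ℕ} (hk : k ≤ s + t) (j : ℕ) :
    wk s t U k - (s + t) * j ∈ MU s t U := by
  rcases hk.lt_or_eq with h | h
  · exact ⟨k, h, j, rfl⟩
  · refine ⟨0, by omega, j, ?_⟩
    rw [h, wk_n hU hc, wk_zero]

lemma MU_good {s t : ℕ} (hs : 0 < s) (hst : Nat.Coprime s t) {U : Finset ℕ}
    (hU : U ⊆ Finset.range (s + t)) (hc : U.card = t) : Good s t (MU s t U) := by
  constructor
  · rintro x ⟨k, hk, j, rfl⟩
    obtain ⟨l, hl, hw⟩ : ∃ l < s + t, wk s t U k = wk s t U (l + 1) := by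
      rcases Nat.eq_zero_or_pos k with h0 | h0
      · refine ⟨s + t - 1, by omega, ?_⟩
        rw [Nat.sub_add_cancel (by omega), wk_n hU hc, h0, wk_zero]
      · exact ⟨k - 1, by omega, by rw [Nat.sub_add_cancel h0]⟩
    rw [hw, wk_succ]
    split_ifs
    · exact ⟨l, hl, j, by ring⟩
    · exact ⟨l, hl, j + 1, by push_cast; ring⟩
  · rintro x ⟨k, hk, j, rfl⟩
    have hw := wk_succ s t U k
    split_ifs at hw
    · convert MU_mem' hs hU hc (show k + 1 ≤ s + t by omega) (j + 1) using 1
      rw [hw]; push_cast; ring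
    · convert MU_mem' hs hU hc (show k + 1 ≤ s + t by omega) j using 1
      rw [hw]; ring
  · refine ⟨(s + t) * t, ?_⟩
    rintro x ⟨k, hk, j, rfl⟩
    have h1 : (U.filter (· < k)).card ≤ t := hc ▸ Finset.card_filter_le _ _
    have h2 : ((s:ℤ) + t) * ((U.filter (· < k)).card : ℤ) ≤ (s + t) * t := by
      gcongr
    have h3 : 0 ≤ ((s:ℤ) + t) * j := by positivity
    have h4 : 0 ≤ (t:ℤ) * k := by positivity
    unfold wk
    linarith
  · refine ⟨-(t * (s + t)), fun x hx => ?_⟩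
    obtain ⟨k, hk, e, he⟩ := wk_surj hs hst U x
    have h1 : -((t:ℤ) * (s + t)) ≤ wk s t U k := by
      unfold wk
      have h3 : 0 ≤ ((s:ℤ) + t) * ((U.filter (· < k)).card : ℤ) := by positivity
      have h4 : (t:ℤ) * k ≤ t * (s + t) := by gcongr; exact_mod_cast hk.le
      linarith
    have hj0 : 0 ≤ e := by
      by_contra hc
      have : ((s:ℤ) + t) * e < 0 := mul_neg_of_pos_of_neg (by positivity) (by omega)
      omega
    obtain ⟨j', rfl⟩ := Int.eq_ofNat_of_zero_le hj0
    refine ⟨k, hk, j', ?_⟩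
    try simp only [Int.ofNat_eq_natCast] at he
    linear_combination -he

lemma MU_bdry {s t : ℕ} (hs : 0 < s) (hst : Nat.Coprime s t) {U : Finset ℕ}
    (hU : U ⊆ Finset.range (s + t)) (hc : U.card = t) {k : ℕ} (hk : k ≤ s + t) :
    wk s t U k ∈ Bdry s t (MU s t U) := by
  have key : ∀ k < s + t, wk s t U k ∈ Bdry s t (MU s t U) := by
    intro k hk
    refine ⟨⟨k, hk, 0, by simp⟩, ?_⟩
    rintro ⟨l, hl, j, he⟩
    have : k = l := wk_inj hst U hk hl ⟨-(j + 1), by linear_combination he⟩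
    subst this
    have h3 : 0 ≤ ((s:ℤ) + t) * j := by positivity
    omega
  rcases hk.lt_or_eq with h | h
  · exact key k h
  · rw [h, wk_n hU hc, ← wk_zero s t U]
    exact key 0 (by omega)

lemma word_surj {s t : ℕ} (hs : 0 < s) (ht : 0 < t) (hst : Nat.Coprime s t) {U : Finset ℕ}
    (hU : U ⊆ Finset.range (s + t)) (hc : U.card = t) :
    ∃ (p : YPartition) (a : ℤ), (p.IsCore s ∧ p.IsCore t) ∧ a ∈ Bdry s t (maya p) ∧
      ups s t (maya p) a (s + t) = U := by
  have hg := MU_good hs hst hU hc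
  obtain ⟨B, hB⟩ := hg.bd
  obtain ⟨L, hL⟩ := hg.low
  obtain ⟨p, c, hp⟩ := exists_partition _ B L hB hL
  have hbd : ∀ x, x ∈ Bdry s t (maya p) ↔ x + c ∈ Bdry s t (MU s t U) := by
    intro x
    simp only [Bdry, Set.mem_ofPred_eq, hp]
    rw [show x + ((s:ℤ) + t) + c = x + c + (s + t) by ring]
  refine ⟨p, -c, ⟨(core_iff p s hs).mpr fun x hx => ?_, (core_iff p t ht).mpr fun x hx => ?_⟩,
    ?_, ?_⟩
  · rw [hp] at hx ⊢
    convert hg.cs _ hx using 1; ring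
  · rw [hp] at hx ⊢
    convert hg.ct _ hx using 1; ring
  · rw [hbd]
    have := MU_bdry hs hst hU hc (Nat.zero_le _)
    rw [wk_zero] at this
    simpa using this
  · have hstep : ∀ k < s + t, (wk s t U k - c + s ∈ maya p ↔ k ∈ U) := by
      intro k hk
      have h1 := MU_bdry hs hst hU hc (show k + 1 ≤ s + t by omega)
      rw [wk_succ] at h1
      rw [hp]
      split_ifs at h1 with h
      · simp only [h, iff_true]
        convert h1.1 using 1; ring
      · simp only [h, iff_false]
        convert h1.2 using 2; ring
    have hw : ∀ k ≤ s + t, walk s t (maya p) (-c) k = wk s t U k - c := by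
      intro k
      induction k with
      | zero => intro _; simp [walk, wk_zero]
      | succ k ih =>
        intro hk
        rw [walk, ih (by omega), wk_succ]
        simp only [hstep k (by omega)]
        split_ifs <;> ring
    ext k
    simp only [ups, Finset.mem_filter, Finset.mem_range]
    constructor
    · rintro ⟨h1, h2⟩
      rw [hw k h1.le] at h2
      exact (hstep k h1).mp h2
    · intro h
      have h1 := Finset.mem_range.mp (hU h)
      exact ⟨h1, by rw [hw k h1.le]; exact (hstep k h1).mpr h⟩

lemma word_inj {s t : ℕ} (hs : 0 < s) (ht : 0 < t) (hst : Nat.Coprime s t) {p q : YPartition}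
    (hp : p.IsCore s ∧ p.IsCore t) (hq : q.IsCore s ∧ q.IsCore t) {a b : ℤ}
    (ha : a ∈ Bdry s t (maya p)) (hb : b ∈ Bdry s t (maya q))
    (h : ups s t (maya p) a (s + t) = ups s t (maya q) b (s + t)) : p = q ∧ a = b := by
  have := maya_shift p q (b - a) (fun x => by
    rw [mem_iff_walk hs hst (good_maya s t hs ht p hp.1 hp.2) ha,
      mem_iff_walk hs hst (good_maya s t hs ht q hq.1 hq.2) hb, h]
    constructor
    · rintro ⟨k, hk, j, rfl⟩
      exact ⟨k, hk, j, by ring⟩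
    · rintro ⟨k, hk, j, hx⟩
      exact ⟨k, hk, j, by linear_combination hx⟩)
  exact ⟨this.1, by omega⟩

/-- The boundary element in a residue class. -/
noncomputable def start (s t : ℕ) (p : YPartition) (r : ℕ) : ℤ :=
  Classical.epsilon (fun a => a ∈ Bdry s t (maya p) ∧ ((s : ℤ) + t) ∣ a - r)

open YPartition in
/-- (Anderson) For coprime `s, t`, the set of `(s,t)`-core partitions is finite of
cardinality `C(s+t, s)/(s+t)`. -/
theorem count_st_cores (s t : ℕ) (hs : 0 < s) (ht : 0 < t) (hst : Nat.Coprime s t) :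
    {p : YPartition | IsCore s p ∧ IsCore t p}.Finite ∧
    (s + t) * {p : YPartition | IsCore s p ∧ IsCore t p}.ncard = Nat.choose (s + t) s := by
  set C := {p : YPartition | IsCore s p ∧ IsCore t p} with hC
  have hstart : ∀ p ∈ C, ∀ r : ℕ, start s t p r ∈ Bdry s t (maya p) ∧
      ((s : ℤ) + t) ∣ start s t p r - r := by
    intro p hp r
    obtain ⟨a, h1, h2⟩ := bdry_exists hs (good_maya s t hs ht p hp.1 hp.2) (r : ℤ)
    exact Classical.epsilon_spec
      (p := fun a => a ∈ Bdry s t (maya p) ∧ ((s : ℤ) + t) ∣ a - r) ⟨a, h1, h2⟩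
  let F : ℕ × YPartition → Finset ℕ := fun x => ups s t (maya x.2) (start s t x.2 x.1) (s + t)
  let R : Set ℕ := ↑(Finset.range (s + t))
  have hbij : Set.BijOn F (R ×ˢ C) ↑(Finset.powersetCard t (Finset.range (s + t))) := by
    refine ⟨?_, ?_, ?_⟩
    · rintro ⟨r, p⟩ ⟨hr, hp⟩
      rw [Finset.mem_coe, Finset.mem_powersetCard]
      refine ⟨?_, ups_card hs (good_maya s t hs ht p hp.1 hp.2) (hstart p hp r).1⟩
      classical
      exact Finset.filter_subset _ _
    · rintro ⟨r, p⟩ ⟨hr, hp⟩ ⟨r', q⟩ ⟨hr', hq⟩ h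
      obtain ⟨h1, h2⟩ := word_inj hs ht hst hp hq (hstart p hp r).1 (hstart q hq r').1 h
      try simp only at h1 h2
      subst h1
      have h3 := (hstart p hp r).2
      have h4 := (hstart p hp r').2
      rw [← h2] at h4
      have h5 : ((s : ℤ) + t) ∣ (r : ℤ) - r' := by
        have := dvd_sub h4 h3
        have e : (r : ℤ) - r' = (start s t p r - r') - (start s t p r - r) := by ring
        rw [e]; exact this
      have hr1 : r < s + t := by simpa [R] using hr
      have hr2 : r' < s + t := by simpa [R] using hr'
      have h6 : (r : ℤ) - r' = 0 := Int.eq_zero_of_abs_lt_dvd h5 (by rw [abs_lt]; omega)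
      have : r = r' := by omega
      rw [this]
    · intro U hU
      rw [Finset.mem_coe, Finset.mem_powersetCard] at hU
      obtain ⟨p, a, hp, ha, hu⟩ := word_surj hs ht hst hU.1 hU.2
      have hn : (0 : ℤ) < s + t := by positivity
      have h0 := Int.emod_nonneg a hn.ne'
      have h1 := Int.emod_lt_of_pos a hn
      obtain ⟨r, hr⟩ := Int.eq_ofNat_of_zero_le h0
      refine ⟨(r, p), ⟨?_, hp⟩, ?_⟩
      · simp only [R, Finset.coe_range, Set.mem_Iio]; omega
      · have hst' := hstart p hp r
        have : start s t p r = a := by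
          refine bdry_unique hs (good_maya s t hs ht p hp.1 hp.2) ha hst'.1 ?_
          have h2 : ((s : ℤ) + t) ∣ a - r := by
            have := Int.dvd_self_sub_emod (x := a) (m := (s : ℤ) + t)
            rw [hr] at this; exact this
          have := dvd_sub hst'.2 h2
          have e : start s t p r - a = (start s t p r - r) - (a - r) := by ring
          rw [e]; exact this
        simp only [F]
        rw [this, hu]
  have hfin : (R ×ˢ C).Finite := hbij.finite_iff_finite.mpr (Finset.finite_toSet _)
  have hcard : (R ×ˢ C).ncard = Nat.choose (s + t) t := by
    rw [← hbij.injOn.ncard_image, hbij.image_eq, Set.ncard_coe_finset,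
      Finset.card_powersetCard, Finset.card_range]
  constructor
  · refine (hfin.image Prod.snd).subset fun p hp => ⟨(0, p), ⟨?_, hp⟩, rfl⟩
    simp only [R, Finset.coe_range, Set.mem_Iio]; omega
  · rw [Set.ncard_prod] at hcard
    rw [show R.ncard = s + t by simp [R, Set.ncard_coe_finset, -Finset.coe_range]] at hcard
    rw [hcard, Nat.choose_symm_add]
end

section
/- Let s and t be coprime positive integers. Then the set of partitions that are self-conjugate (s,t)-cores is finite and has cardinality C(⌊s/2⌋+⌊t/2⌋, ⌊s/2⌋). -/
namespace SCCore

/-- Bead set of a partition. -/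
def beads (p : YPartition) : Set ℤ := {n | ∃ i : ℕ, n = (p.parts i : ℤ) - i - 1}

/-- Symmetric sets of integers. -/
def Symm (B : Set ℤ) : Prop := ∀ n, n ∈ B ↔ -1 - n ∉ B

/-- Sets closed under subtracting `c`. -/
def Closed (c : ℤ) (B : Set ℤ) : Prop := ∀ n ∈ B, n - c ∈ B

lemma lt_conj (p : YPartition) (i j : ℕ) : i < p.conj j ↔ j < p.parts i := by
  obtain ⟨N, hN⟩ := p.finite_support
  have hex : ∃ i, p.parts i ≤ j := ⟨N, by rw [hN N le_rfl]; omega⟩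
  classical
  have hset : {i : ℕ | j < p.parts i} = Set.Iio (Nat.find hex) := by
    ext i
    simp only [Set.mem_setOf_eq, Set.mem_Iio]
    constructor
    · intro h
      by_contra h'
      have := p.antitone (not_lt.mp h')
      have := Nat.find_spec hex
      omega
    · intro h
      have := Nat.find_min hex h
      omega
  have hc : p.conj j = Nat.find hex := by
    unfold YPartition.conj
    rw [hset, ← Finset.coe_Iio, Set.ncard_coe_finset, Nat.card_Iio]
  have : i ∈ {i : ℕ | j < p.parts i} ↔ i ∈ Set.Iio (Nat.find hex) := by rw [hset]
  simp only [Set.mem_setOf_eq, Set.mem_Iio] at this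
  rw [hc, this]

lemma gap_not_mem (p : YPartition) (j : ℕ) : (j : ℤ) - p.conj j ∉ beads p := by
  rintro ⟨i, hi⟩
  have := lt_conj p i j
  omega

lemma exists_gap (p : YPartition) (n : ℤ) (hn : n ∉ beads p) :
    ∃ j : ℕ, n = (j : ℤ) - p.conj j := by
  classical
  obtain ⟨N, hN⟩ := p.finite_support
  have hex : ∃ i : ℕ, (p.parts i : ℤ) - i - 1 < n := by
    refine ⟨N + n.natAbs, ?_⟩
    rw [hN _ (by omega)]
    omega
  have hspec := Nat.find_spec hex
  have hmin := fun m => @Nat.find_min _ _ hex m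
  generalize Nat.find hex = i at hspec hmin
  have h0 : 0 ≤ n + i := by omega
  refine ⟨(n + i).toNat, ?_⟩
  have h1 := lt_conj p i (n + i).toNat
  rcases Nat.eq_zero_or_pos i with h | h
  · omega
  · have h2 := lt_conj p (i - 1) (n + i).toNat
    have h3 := hmin (i - 1) (by omega)
    have h4 : n ≠ (p.parts (i - 1) : ℤ) - (i - 1 : ℕ) - 1 := fun hh => hn ⟨_, hh⟩
    omega

lemma isCore_iff (p : YPartition) (t : ℕ) (ht : 0 < t) :
    p.IsCore t ↔ Closed t (beads p) := by
  constructor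
  · rintro h n ⟨i, hi⟩
    by_contra hn
    obtain ⟨j, hj⟩ := exists_gap p _ hn
    have h1 := lt_conj p i j
    refine h i j ?_ ?_
    · show j < p.parts i
      omega
    · unfold YPartition.hook
      omega
  · intro h i j hij hh
    have hij' : j < p.parts i := hij
    have h1 := (lt_conj p i j).2 hij'
    have h2 := h _ ⟨i, rfl⟩
    apply gap_not_mem p j
    unfold YPartition.hook at hh
    convert h2 using 1
    omega

lemma strict_parts (p : YPartition) : StrictMono (fun j : ℕ => (j : ℤ) - p.parts j) := by
  intro a b hab
  have := p.antitone hab.le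
  simp only
  omega

lemma strict_conj (p : YPartition) : StrictMono (fun j : ℕ => (j : ℤ) - p.conj j) := by
  intro a b hab
  have : p.conj b ≤ p.conj a := by
    by_contra h
    have h1 := lt_conj p (p.conj a) b
    have h2 := lt_conj p (p.conj a) a
    omega
  simp only
  omega

lemma selfConj_iff (p : YPartition) : p.SelfConj ↔ Symm (beads p) := by
  constructor
  · intro h n
    constructor
    · rintro ⟨i, hi⟩
      have := gap_not_mem p i
      rw [h i] at this
      convert this using 1
      rw [show -1 - n = (i : ℤ) - p.parts i by omega]
    · intro hn
      by_contra hn'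
      obtain ⟨j, hj⟩ := exists_gap p _ hn'
      rw [h j] at hj
      exact hn ⟨j, by omega⟩
  · intro h
    have hr : Set.range (fun j : ℕ => (j : ℤ) - p.conj j)
        = Set.range (fun j : ℕ => (j : ℤ) - p.parts j) := by
      ext n
      constructor
      · rintro ⟨j, rfl⟩
        have h1 := gap_not_mem p j
        have h2 := (h (-1 - ((j : ℤ) - p.conj j))).2 (by simpa using h1)
        obtain ⟨i, hi⟩ := h2
        exact ⟨i, by simp only; omega⟩
      · rintro ⟨j, rfl⟩
        have h1 : (p.parts j : ℤ) - j - 1 ∈ beads p := ⟨j, rfl⟩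
        have h2 := (h _).1 h1
        obtain ⟨i, hi⟩ := exists_gap p _ h2
        exact ⟨i, by simp only; omega⟩
    have := (StrictMono.range_inj (strict_conj p) (strict_parts p)).1 hr
    intro j
    have := congrFun this j
    omega

lemma beads_injective : Function.Injective beads := by
  intro p q h
  have hr : Set.range (fun j : ℕ => (j : ℤ) - p.parts j)
      = Set.range (fun j : ℕ => (j : ℤ) - q.parts j) := by
    ext n
    have : -1 - n ∈ beads p ↔ -1 - n ∈ beads q := by rw [h]
    constructor
    · rintro ⟨j, hj⟩
      obtain ⟨i, hi⟩ := this.1 ⟨j, by simp only at hj; omega⟩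
      exact ⟨i, by simp only; omega⟩
    · rintro ⟨j, hj⟩
      obtain ⟨i, hi⟩ := this.2 ⟨j, by simp only at hj; omega⟩
      exact ⟨i, by simp only; omega⟩
  have := (StrictMono.range_inj (strict_parts p) (strict_parts q)).1 hr
  have hp : p.parts = q.parts := by
    funext j
    have := congrFun this j
    omega
  cases p; cases q
  simp only at hp
  subst hp
  rfl

/-- counting with an antisymmetric predicate -/
lemma count_half (M : ℕ) (q : ℕ → Prop) [DecidablePred q]
    (h : ∀ n, n < 2 * M → (q n ↔ ¬ q (2 * M - 1 - n))) : Nat.count q (2 * M) = M := by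
  rw [Nat.count_eq_card_filter_range]
  have h1 : ((Finset.range (2 * M)).filter q).card
      = ((Finset.range (2 * M)).filter (fun n => ¬ q n)).card := by
    apply Finset.card_bij' (fun n _ => 2 * M - 1 - n) (fun n _ => 2 * M - 1 - n)
    · intro n hn
      simp only [Finset.mem_filter, Finset.mem_range] at hn ⊢
      exact ⟨by omega, (h n hn.1).1 hn.2⟩
    · intro n hn
      simp only [Finset.mem_filter, Finset.mem_range] at hn ⊢
      refine ⟨by omega, ?_⟩
      by_contra h'
      exact hn.2 ((h n hn.1).2 h')
    · intro n hn
      simp only [Finset.mem_filter, Finset.mem_range] at hn ⊢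
      omega
    · intro n hn
      simp only [Finset.mem_filter, Finset.mem_range] at hn ⊢
      omega
  have h2 : ((Finset.range (2 * M)).filter q).card
      + ((Finset.range (2 * M)).filter (fun n => ¬ q n)).card = 2 * M := by
    rw [Finset.card_filter_add_card_filter_not, Finset.card_range]
  have h3 : ((Finset.range (2 * M)).filter q).card = M := by omega
  exact h3

lemma exists_partition (B : Set ℤ) (hB : Symm B) (M : ℕ) (hM : ∀ n ∈ B, n < M) :
    ∃ p, beads p = B := by
  classical
  set q : ℕ → Prop := fun n => (M : ℤ) - 1 - n ∈ B with hq
  have hbig : ∀ n, 2 * M ≤ n → q n := by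
    intro n hn
    rw [hq]
    simp only
    rw [hB]
    intro h
    have := hM _ h
    omega
  have hc0 : Nat.count q (2 * M) = M := by
    apply count_half
    intro n hn
    simp only [hq]
    rw [hB]
    rw [show (-1 : ℤ) - (M - 1 - n) = M - 1 - (2 * M - 1 - n : ℕ) by omega]
  have hc : ∀ k, Nat.count q (2 * M + k) = M + k := by
    intro k
    induction k with
    | zero => simpa using hc0
    | succ k ih => rw [← add_assoc, Nat.count_succ, ih, if_pos (hbig _ (by omega))]; rfl
  have hnth : ∀ k, Nat.nth q (M + k) = 2 * M + k := by
    intro k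
    rw [← hc k]
    exact Nat.nth_count (hbig _ (by omega))
  have hinf : {n | q n}.Infinite := by
    apply Set.infinite_of_injective_forall_mem (f := fun k => 2 * M + k)
    · intro a b h; simp only at h; omega
    · intro k; exact hbig _ (by omega)
  have hmono := Nat.nth_strictMono hinf
  have hanti : Antitone (fun i : ℕ => (M : ℤ) - Nat.nth q i + i) := by
    apply antitone_nat_of_succ_le
    intro i
    have : Nat.nth q i < Nat.nth q (i + 1) := hmono (Nat.lt_succ_self i)
    omega
  have hzero : ∀ i, M ≤ i → (M : ℤ) - Nat.nth q i + i = 0 := by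
    intro i hi
    obtain ⟨k, rfl⟩ := Nat.exists_eq_add_of_le hi
    rw [hnth k]
    push_cast; ring
  have hnn : ∀ i : ℕ, 0 ≤ (M : ℤ) - Nat.nth q i + i := by
    intro i
    have h1 := hanti (show i ≤ M + i by omega)
    have h2 := hzero (M + i) (by omega)
    simp only at h1
    omega
  refine ⟨⟨fun i => ((M : ℤ) - Nat.nth q i + i).toNat, ?_, ⟨M, ?_⟩⟩, ?_⟩
  · intro i j hij
    exact Int.toNat_le_toNat (hanti hij)
  · intro i hi
    rw [hzero i hi]; rfl
  · ext n
    constructor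
    · rintro ⟨i, hi⟩
      simp only at hi
      have h1 := hnn i
      have h2 : q (Nat.nth q i) := Nat.nth_mem_of_infinite hinf i
      have h3 : (M : ℤ) - 1 - (Nat.nth q i : ℕ) ∈ B := h2
      convert h3 using 1
      omega
    · intro hn
      have h1 := hM n hn
      have h2 : q (M - 1 - n).toNat := by
        simp only [hq]
        convert hn using 1
        omega
      refine ⟨Nat.count q (M - 1 - n).toNat, ?_⟩
      have h3 := Nat.nth_count h2
      have h4 := hnn (Nat.count q (M - 1 - n).toNat)
      simp only
      rw [h3] at h4 ⊢
      omega

/-- The set generated by a half-walk `u`. -/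
def Phi (N : ℤ) (h : ℕ) (u : ℕ → ℤ) : Set ℤ :=
  {n | ∃ k ≤ h, ∃ m : ℕ, n = u k - N * m ∨ n = -1 - N - u k - N * m}

/-- A good half walk. -/
structure Good (s t h : ℕ) (u : ℕ → ℤ) : Prop where
  hs : 0 < s
  ht : 0 < t
  cop : Nat.Coprime s (s + t)
  step : ∀ k < h, u (k + 1) = u k + t ∨ u (k + 1) = u k - s
  start : 2 * u 0 = -1 - s
  fin : (s + t = 2 * h + 1 ∧ 2 * u h = -1 - (s + t)) ∨
    (s + t = 2 * h + 2 ∧ 2 * u h = -1 - t)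
  cls : ∀ k ≤ h, ∃ a : ℤ, u k = u 0 + (s + t) * a - k * s

variable {s t h : ℕ} {u : ℕ → ℤ}

lemma Phi_left {N : ℤ} {n : ℤ} (k : ℕ) (hk : k ≤ h) (m : ℕ) (e : n = u k - N * m) :
    n ∈ Phi N h u := ⟨k, hk, m, Or.inl e⟩

lemma Phi_right {N : ℤ} {n : ℤ} (k : ℕ) (hk : k ≤ h) (m : ℕ) (e : n = -1 - N - u k - N * m) :
    n ∈ Phi N h u := ⟨k, hk, m, Or.inr e⟩

lemma Good.right_s (g : Good s t h u) (k : ℕ) (hk : k ≤ h) (m : ℕ) :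
    -1 - ((s : ℤ) + t) - u k - (s + t) * m - s ∈ Phi (s + t) h u := by
  rcases k with _ | k
  · refine Phi_left 0 (by omega) (m + 1) ?_
    have := g.start
    push_cast
    linarith
  · rcases g.step k (by omega) with e | e
    · refine Phi_right k (by omega) (m + 1) ?_
      push_cast
      linarith
    · refine Phi_right k (by omega) m ?_
      linarith

lemma Good.left_t (g : Good s t h u) (k : ℕ) (hk : k ≤ h) (m : ℕ) :
    u k - (s + t) * m - t ∈ Phi (s + t) h u := by
  rcases k with _ | k
  · refine Phi_right 0 (by omega) m ?_
    have := g.start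
    linarith
  · rcases g.step k (by omega) with e | e
    · refine Phi_left k (by omega) m ?_
      linarith
    · refine Phi_left k (by omega) (m + 1) ?_
      push_cast
      linarith

lemma Good.closed_s (g : Good s t h u) : Closed s (Phi (s + t) h u) := by
  rintro n ⟨k, hk, m, e | e⟩
  · rcases hk.lt_or_eq with hk' | rfl
    · rcases g.step k hk' with e' | e'
      · refine Phi_left (k + 1) (by omega) (m + 1) ?_
        push_cast
        linarith
      · refine Phi_left (k + 1) (by omega) m ?_
        linarith
    · rcases g.fin with ⟨e1, e2⟩ | ⟨e1, e2⟩
      · have := g.right_s k le_rfl m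
        convert this using 1
        linarith
      · refine Phi_right k le_rfl m ?_
        linarith
  · rw [e]
    exact g.right_s k hk m

lemma Good.closed_t (g : Good s t h u) : Closed t (Phi (s + t) h u) := by
  rintro n ⟨k, hk, m, e | e⟩
  · rw [e]
    exact g.left_t k hk m
  · rcases hk.lt_or_eq with hk' | rfl
    · rcases g.step k hk' with e' | e'
      · refine Phi_right (k + 1) (by omega) m ?_
        linarith
      · refine Phi_right (k + 1) (by omega) (m + 1) ?_
        push_cast
        linarith
    · rcases g.fin with ⟨e1, e2⟩ | ⟨e1, e2⟩
      · have := g.left_t k le_rfl m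
        convert this using 1
        linarith
      · refine Phi_left k le_rfl (m + 1) ?_
        push_cast
        linarith

lemma Good.dvd (g : Good s t h u) {x y : ℤ} (e : x * s = (s + t) * y) : ((s : ℤ) + t) ∣ x := by
  have h1 : ((s : ℤ) + t) ∣ x * s := ⟨y, e⟩
  have h2 : IsCoprime ((s : ℤ) + t) (s : ℤ) := by
    have := Nat.isCoprime_iff_coprime.2 g.cop
    push_cast at this
    exact this.symm
  exact h2.dvd_of_dvd_mul_right h1

lemma Good.sum_ne (g : Good s t h u) (k l : ℕ) (hk : k ≤ h) (hl : l ≤ h) (M : ℤ)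
    (e : u k + u l + 1 = (s + t) * M) : M = -1 := by
  obtain ⟨a, ha⟩ := g.cls k hk
  obtain ⟨b, hb⟩ := g.cls l hl
  have h0 := g.start
  have hs := g.hs
  have hd := g.dvd (x := k + l + 1) (y := a + b - M) (by linarith)
  have hle := Int.le_of_dvd (by omega) hd
  rcases g.fin with ⟨e1, e2⟩ | ⟨e1, e2⟩
  · have hk' : k = h := by omega
    have hl' : l = h := by omega
    subst hk'
    subst hl'
    have : ((s : ℤ) + t) * (M + 1) = 0 := by linarith
    rcases mul_eq_zero.1 this with h | h <;> omega
  · omega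

lemma Good.diff_ne (g : Good s t h u) (k l : ℕ) (hk : k ≤ h) (hl : l ≤ h) (M : ℤ)
    (e : u k - u l = (s + t) * M) : M = 0 := by
  obtain ⟨a, ha⟩ := g.cls k hk
  obtain ⟨b, hb⟩ := g.cls l hl
  have hs := g.hs
  have hd := g.dvd (x := k - l) (y := a - b - M) (by linarith)
  have hlt : |(k : ℤ) - l| < s + t := by
    rw [abs_lt]
    rcases g.fin with ⟨e1, e2⟩ | ⟨e1, e2⟩ <;> omega
  have := Int.eq_zero_of_abs_lt_dvd hd hlt
  have : k = l := by omega
  subst this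
  have : ((s : ℤ) + t) * M = 0 := by linarith
  rcases mul_eq_zero.1 this with h | h <;> omega

lemma Good.excl (g : Good s t h u) (n : ℤ) (h1 : n ∈ Phi (s + t) h u)
    (h2 : -1 - n ∈ Phi (s + t) h u) : False := by
  obtain ⟨k, hk, m, e | e⟩ := h1 <;> obtain ⟨l, hl, m', e' | e'⟩ := h2
  · have := g.sum_ne k l hk hl (m + m') (by linarith)
    omega
  · have := g.diff_ne k l hk hl (m + m' + 1) (by linarith)
    omega
  · have := g.diff_ne l k hl hk (m + m' + 1) (by linarith)
    omega
  · have := g.sum_ne k l hk hl (-2 - m - m') (by linarith)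
    omega

lemma Good.exh (g : Good s t h u) (n : ℤ) :
    n ∈ Phi (s + t) h u ∨ -1 - n ∈ Phi (s + t) h u := by
  have hs := g.hs
  have h2 : IsCoprime (s : ℤ) ((s : ℤ) + t) := by
    have := Nat.isCoprime_iff_coprime.2 g.cop
    push_cast at this
    exact this
  obtain ⟨x, y, hxy⟩ := h2
  have hNpos : (0 : ℤ) < s + t := by omega
  obtain ⟨j, c, hj0, hjN, hj⟩ : ∃ j c : ℤ, 0 ≤ j ∧ j < s + t ∧ n = u 0 - j * s + (s + t) * c := by
    set z := (u 0 - n) * x with hz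
    refine ⟨z % (s + t), - (u 0 - n) * y - s * (z / (s + t)), Int.emod_nonneg _ (by omega),
      Int.emod_lt_of_pos _ hNpos, ?_⟩
    have h3 := Int.emod_add_mul_ediv z (s + t)
    have h4 : z % (s + t) = z - (s + t) * (z / (s + t)) := by linarith
    rw [h4]
    generalize z / ((s : ℤ) + t) = w
    rw [hz]
    linear_combination (u 0 - n) * hxy
  by_cases hjh : j ≤ h
  · obtain ⟨k, rfl⟩ := Int.eq_ofNat_of_zero_le hj0
    have hk : k ≤ h := by omega
    obtain ⟨a, ha⟩ := g.cls k hk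
    rcases le_or_gt (c - a) 0 with hq | hq
    · left
      refine Phi_left k hk (a - c).toNat ?_
      rw [Int.toNat_of_nonneg (by omega)]
      linarith
    · right
      refine Phi_right k hk (c - a - 1).toNat ?_
      rw [Int.toNat_of_nonneg (by omega)]
      linarith
  · obtain ⟨k, hk'⟩ := Int.eq_ofNat_of_zero_le (show 0 ≤ (s : ℤ) + t - 1 - j by omega)
    have hk : k ≤ h := by
      rcases g.fin with ⟨e1, e2⟩ | ⟨e1, e2⟩ <;> omega
    obtain ⟨a, ha⟩ := g.cls k hk
    have hj' : j = (s : ℤ) + t - 1 - k := by omega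
    have h0 := g.start
    have hn : n = -1 - (s + t) - u k + (s + t) * (1 + c + a - s) := by
      rw [hj, hj', ha]
      linear_combination h0
    generalize (1 + c + a - (s : ℤ)) = q at hn
    rcases le_or_gt q 0 with hq | hq
    · left
      refine Phi_right k hk (-q).toNat ?_
      rw [Int.toNat_of_nonneg (by omega)]
      linarith
    · right
      refine Phi_left k hk (q - 1).toNat ?_
      rw [Int.toNat_of_nonneg (by omega)]
      linarith

lemma Good.symm (g : Good s t h u) : Symm (Phi (s + t) h u) := by
  intro n
  constructor
  · intro h1 h2
    exact g.excl n h1 h2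
  · intro h1
    exact (g.exh n).resolve_right h1

lemma Good.bdd (g : Good s t h u) : ∃ M : ℕ, ∀ n ∈ Phi (s + t) h u, n < M := by
  refine ⟨∑ k ∈ Finset.range (h + 1), (u k).natAbs + 1, ?_⟩
  rintro n ⟨k, hk, m, e⟩
  have h1 : (u k).natAbs ≤ ∑ k ∈ Finset.range (h + 1), (u k).natAbs :=
    Finset.single_le_sum (f := fun k => (u k).natAbs) (fun _ _ => Nat.zero_le _)
      (Finset.mem_range.2 (by omega))
  have h2 : 0 ≤ ((s : ℤ) + t) * m := by positivity
  generalize ((s : ℤ) + t) * m = z at *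
  omega

/-- The walk attached to a set of up steps. -/
def walk (r t : ℕ) (A : Finset ℕ) (k : ℕ) : ℤ :=
  -(r + 1) + (2 * r + 1 + t) * (A.filter (· < k)).card - k * (2 * r + 1)

lemma card_filter_succ (A : Finset ℕ) (k : ℕ) :
    (A.filter (· < k + 1)).card = (A.filter (· < k)).card + if k ∈ A then 1 else 0 := by
  classical
  split_ifs with hk
  · have : A.filter (· < k + 1) = insert k (A.filter (· < k)) := by
      ext x
      simp only [Finset.mem_filter, Finset.mem_insert]
      constructor
      · rintro ⟨h1, h2⟩
        by_cases hx : x = k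
        · exact Or.inl hx
        · exact Or.inr ⟨h1, by omega⟩
      · rintro (rfl | ⟨h1, h2⟩)
        · exact ⟨hk, by omega⟩
        · exact ⟨h1, by omega⟩
    rw [this, Finset.card_insert_of_notMem (by simp)]
  · rw [add_zero]
    congr 1
    ext x
    simp only [Finset.mem_filter]
    constructor
    · rintro ⟨h1, h2⟩
      have : x ≠ k := fun hh => hk (hh ▸ h1)
      exact ⟨h1, by omega⟩
    · rintro ⟨h1, h2⟩
      exact ⟨h1, by omega⟩

lemma walk_zero (r t : ℕ) (A : Finset ℕ) : walk r t A 0 = -(r + 1) := by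
  simp [walk]

lemma walk_succ_mem (r t : ℕ) (A : Finset ℕ) (k : ℕ) (hk : k ∈ A) :
    walk r t A (k + 1) = walk r t A k + t := by
  unfold walk
  rw [card_filter_succ, if_pos hk]
  push_cast
  ring

lemma walk_succ_notMem (r t : ℕ) (A : Finset ℕ) (k : ℕ) (hk : k ∉ A) :
    walk r t A (k + 1) = walk r t A k - (2 * r + 1) := by
  unfold walk
  rw [card_filter_succ, if_neg hk]
  push_cast
  ring

lemma walk_good (r t : ℕ) (ht : 0 < t) (hc : Nat.Coprime (2 * r + 1) t) (A : Finset ℕ)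
    (hA : A ∈ Finset.powersetCard r (Finset.range (r + t / 2))) :
    Good (2 * r + 1) t (r + t / 2) (walk r t A) := by
  rw [Finset.mem_powersetCard] at hA
  have hfull : A.filter (· < r + t / 2) = A := by
    apply Finset.filter_true_of_mem
    intro x hx
    exact Finset.mem_range.1 (hA.1 hx)
  refine ⟨by omega, ht, by simpa using hc, ?_, ?_, ?_, ?_⟩
  · intro k _
    by_cases hk : k ∈ A
    · left; exact walk_succ_mem r t A k hk
    · right; rw [walk_succ_notMem r t A k hk]; push_cast; ring
  · rw [walk_zero]; push_cast; ring
  · have e : walk r t A (r + t / 2)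
        = -(r + 1) + (2 * r + 1 + t) * r - ((r + t / 2 : ℕ) : ℤ) * (2 * r + 1) := by
      unfold walk
      rw [hfull, hA.2]
    rcases Nat.even_or_odd' t with ⟨q, rfl | rfl⟩
    · left
      refine ⟨by omega, ?_⟩
      rw [e, show 2 * q / 2 = q by omega]
      push_cast
      ring
    · right
      refine ⟨by omega, ?_⟩
      rw [e, show (2 * q + 1) / 2 = q by omega]
      push_cast
      ring
  · intro k _
    refine ⟨(A.filter (· < k)).card, ?_⟩
    rw [walk_zero]
    unfold walk
    push_cast
    ring

lemma closed_mul {B : Set ℤ} {c : ℤ} (hB : Closed c B) (n : ℤ) (hn : n ∈ B) (m : ℕ) :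
    n - c * m ∈ B := by
  induction m with
  | zero => simpa using hn
  | succ m ih =>
    have := hB _ ih
    convert this using 1
    push_cast
    ring

lemma top_unique {B : Set ℤ} {c : ℤ} (hc : 0 < c) (hB : Closed c B) (x y a : ℤ) (hx : x ∈ B)
    (hx' : x + c ∉ B) (hy : y ∈ B) (hy' : y + c ∉ B) (e : x = y + c * a) : x = y := by
  rcases lt_trichotomy a 0 with h | h | h
  · exfalso
    apply hx'
    have := closed_mul hB y hy (-a - 1).toNat
    rw [Int.toNat_of_nonneg (by omega)] at this
    convert this using 1
    rw [e]; ring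
  · rw [e, h]; ring
  · exfalso
    apply hy'
    have := closed_mul hB x hx (a - 1).toNat
    rw [Int.toNat_of_nonneg (by omega)] at this
    convert this using 1
    rw [e]; ring

lemma Good.top (g : Good s t h u) (k : ℕ) (hk : k ≤ h) :
    u k ∈ Phi (s + t) h u ∧ u k + (s + t) ∉ Phi (s + t) h u := by
  constructor
  · exact Phi_left k hk 0 (by simp)
  · intro h1
    apply g.excl _ h1
    exact Phi_right k hk 0 (by push_cast; ring)

lemma closed_add {B : Set ℤ} {c d : ℤ} (hc : Closed c B) (hd : Closed d B) : Closed (c + d) B := by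
  intro n hn
  have := hd _ (hc n hn)
  convert this using 1
  ring

lemma Phi_walk_inj (r t : ℕ) (ht : 0 < t) (hc : Nat.Coprime (2 * r + 1) t) :
    Set.InjOn (fun A => Phi ((2 * r + 1 : ℕ) + t) (r + t / 2) (walk r t A))
      (Finset.powersetCard r (Finset.range (r + t / 2)) : Finset (Finset ℕ)) := by
  intro A hA A' hA' e
  have hA := Finset.mem_coe.1 hA
  have hA' := Finset.mem_coe.1 hA'
  have g := walk_good r t ht hc A hA
  have g' := walk_good r t ht hc A' hA'
  simp only at e
  have hw : ∀ k ≤ r + t / 2, walk r t A k = walk r t A' k := by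
    intro k hk
    have h1 := g.top k hk
    have h2 := g'.top k hk
    rw [← e] at h2
    refine top_unique (by omega) (closed_add g.closed_s g.closed_t) _ _
      ((A.filter (· < k)).card - (A'.filter (· < k)).card) h1.1 h1.2 h2.1 h2.2 ?_
    unfold walk
    push_cast
    ring
  rw [Finset.mem_powersetCard] at hA hA'
  have key : ∀ k < r + t / 2, (k ∈ A ↔ k ∈ A') := by
    intro k hk
    have h1 := hw k (by omega)
    have h2 := hw (k + 1) (by omega)
    by_cases a1 : k ∈ A <;> by_cases a2 : k ∈ A'
    · simp [a1, a2]
    · rw [walk_succ_mem _ _ _ _ a1, walk_succ_notMem _ _ _ _ a2] at h2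
      omega
    · rw [walk_succ_notMem _ _ _ _ a1, walk_succ_mem _ _ _ _ a2] at h2
      omega
    · simp [a1, a2]
  ext k
  by_cases hk : k < r + t / 2
  · exact key k hk
  · constructor
    · intro h; exact absurd (Finset.mem_range.1 (hA.1 h)) hk
    · intro h; exact absurd (Finset.mem_range.1 (hA'.1 h)) hk

lemma symm_eq_of_subset {B C : Set ℤ} (hB : Symm B) (hC : Symm C) (h : B ⊆ C) : B = C := by
  apply Set.Subset.antisymm h
  intro n hn
  rw [hB]
  intro h'
  exact (hC n).1 hn (h h')

open Classical in
/-- The walk traced along the boundary of `B`. -/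
noncomputable def trace (r t : ℕ) (B : Set ℤ) : ℕ → ℤ
  | 0 => -(r + 1)
  | k + 1 => if trace r t B k + t ∈ B then trace r t B k + t else trace r t B k - (2 * r + 1)

lemma exists_walk (r t : ℕ) (ht : 0 < t) (hc : Nat.Coprime (2 * r + 1) t) (B : Set ℤ)
    (hB : Symm B) (h1 : Closed (2 * r + 1 : ℕ) B) (h2 : Closed t B) :
    ∃ A ∈ Finset.powersetCard r (Finset.range (r + t / 2)),
      Phi ((2 * r + 1 : ℕ) + t) (r + t / 2) (walk r t A) = B := by
  classical
  set h := r + t / 2 with hh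
  set A := (Finset.range h).filter (fun k => trace r t B k + t ∈ B) with hA
  have hN := closed_add h1 h2
  have hw : ∀ k ≤ h, walk r t A k = trace r t B k := by
    intro k
    induction k with
    | zero => intro _; rw [walk_zero]; rfl
    | succ k ih =>
      intro hk
      have ih := ih (by omega)
      by_cases hm : trace r t B k + t ∈ B
      · rw [walk_succ_mem _ _ _ _ (by simp [hA, hm]; omega), ih, trace, if_pos hm]
      · rw [walk_succ_notMem _ _ _ _ (by simp [hA, hm]), ih, trace, if_neg hm]
  have htop : ∀ k, trace r t B k ∈ B ∧ trace r t B k + ((2 * r + 1 : ℕ) + t) ∉ B := by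
    intro k
    induction k with
    | zero =>
      have e : -1 - (-((r : ℤ) + 1)) - (2 * r + 1 : ℕ) = -(r + 1) := by push_cast; ring
      have hin : -((r : ℤ) + 1) ∈ B := by
        by_contra hn
        have h3 : -1 - (-((r : ℤ) + 1)) ∈ B := by
          by_contra h4
          exact hn ((hB _).2 h4)
        have := h1 _ h3
        rw [e] at this
        exact hn this
      refine ⟨hin, ?_⟩
      intro h3
      have := h2 _ h3
      apply (hB _).1 hin
      convert this using 1
      simp only [trace]
      push_cast
      ring
    | succ k ih =>
      rw [trace]
      split_ifs with hm
      · refine ⟨hm, fun h3 => ih.2 ?_⟩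
        have := h2 _ h3
        convert this using 1
        ring
      · refine ⟨?_, fun h3 => hm ?_⟩
        · have := h1 _ ih.1
          convert this using 1
          push_cast
          ring
        · convert h3 using 1
          push_cast
          ring
  have hrefl : ∀ k, -1 - ((2 * r + 1 : ℕ) + t) - trace r t B k ∈ B ∧
      -1 - ((2 * r + 1 : ℕ) + t) - trace r t B k + ((2 * r + 1 : ℕ) + t) ∉ B := by
    intro k
    have := htop k
    constructor
    · rw [hB]
      convert this.2 using 2
      ring
    · have := (hB _).1 this.1
      convert this using 2
      ring
  have hfull : A.filter (· < h) = A := by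
    apply Finset.filter_true_of_mem
    intro x hx
    simp only [hA, Finset.mem_filter, Finset.mem_range] at hx
    exact hx.1
  have hend : trace r t B h = -(r + 1) + (2 * r + 1 + t) * A.card - (h : ℤ) * (2 * r + 1) := by
    rw [← hw h le_rfl]
    unfold walk
    rw [hfull]
  have hcard : A.card = r := by
    have hNpos : (0 : ℤ) < (2 * r + 1 : ℕ) + t := by omega
    rcases Nat.even_or_odd' t with ⟨q, hq | hq⟩
    · have hhq : h = r + q := by omega
      have := top_unique hNpos hN _ _ (2 * A.card - 2 * r) (htop h).1 (htop h).2
        (hrefl h).1 (hrefl h).2 (by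
          rw [hend, hhq, hq]; push_cast; ring)
      rw [hend, hhq, hq] at this
      push_cast at this
      have h3 : ((2 * r + 1 + 2 * q : ℕ) : ℤ) * ((A.card : ℤ) - r) = 0 := by
        push_cast
        linarith
      rcases mul_eq_zero.1 h3 with h3 | h3
      · omega
      · omega
    · have hhq : h = r + q := by omega
      have hx := htop (h + 1)
      rw [trace] at hx
      have key : ∃ c : ℤ, (c = 0 ∨ c = 1) ∧
          (if trace r t B h + t ∈ B then trace r t B h + t else trace r t B h - (2 * r + 1))
            = trace r t B h - (2 * r + 1) + (2 * r + 1 + t) * c := by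
        split_ifs
        · exact ⟨1, Or.inr rfl, by ring⟩
        · exact ⟨0, Or.inl rfl, by ring⟩
      obtain ⟨c, hc01, hce⟩ := key
      rw [hce] at hx
      have := top_unique hNpos hN _ _ (2 * A.card - 2 * r + c) hx.1 hx.2
        (hrefl h).1 (hrefl h).2 (by
          rw [hend, hhq, hq]; push_cast; ring)
      rw [hend, hhq, hq] at this
      push_cast at this
      have h3 : ((2 * r + 1 + (2 * q + 1) : ℕ) : ℤ) * (2 * (A.card : ℤ) - 2 * r + c) = 0 := by
        push_cast
        linarith
      rcases mul_eq_zero.1 h3 with h3 | h3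
      · omega
      · omega
  have hAmem : A ∈ Finset.powersetCard r (Finset.range h) := by
    rw [Finset.mem_powersetCard]
    exact ⟨Finset.filter_subset _ _, hcard⟩
  refine ⟨A, hAmem, ?_⟩
  have g := walk_good r t ht hc A hAmem
  apply symm_eq_of_subset g.symm hB
  rintro n ⟨k, hk, m, e | e⟩
  · rw [e, hw k hk]
    exact closed_mul hN _ (htop k).1 m
  · rw [e, hw k hk]
    exact closed_mul hN _ (hrefl k).1 m

open YPartition in
lemma main_odd (r t : ℕ) (ht : 0 < t) (hc : Nat.Coprime (2 * r + 1) t) :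
    {p : YPartition | p.SelfConj ∧ IsCore (2 * r + 1) p ∧ IsCore t p}.Finite ∧
    {p : YPartition | p.SelfConj ∧ IsCore (2 * r + 1) p ∧ IsCore t p}.ncard =
      Nat.choose (r + t / 2) r := by
  set S := {p : YPartition | p.SelfConj ∧ IsCore (2 * r + 1) p ∧ IsCore t p} with hS
  set P := Finset.powersetCard r (Finset.range (r + t / 2)) with hP
  have himg : beads '' S =
      (fun A => Phi ((2 * r + 1 : ℕ) + t) (r + t / 2) (walk r t A)) '' (P : Set (Finset ℕ)) := by
    ext B
    constructor
    · rintro ⟨p, ⟨p1, p2, p3⟩, rfl⟩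
      obtain ⟨A, hA, e⟩ := exists_walk r t ht hc (beads p) ((selfConj_iff p).1 p1)
        ((isCore_iff p _ (by omega)).1 p2) ((isCore_iff p _ ht).1 p3)
      exact ⟨A, Finset.mem_coe.2 hA, e⟩
    · rintro ⟨A, hA, rfl⟩
      have g := walk_good r t ht hc A (Finset.mem_coe.1 hA)
      obtain ⟨M, hM⟩ := g.bdd
      obtain ⟨p, hp⟩ := exists_partition _ g.symm M hM
      refine ⟨p, ⟨?_, ?_, ?_⟩, hp⟩
      · rw [selfConj_iff, hp]; exact g.symm
      · rw [isCore_iff p _ (by omega), hp]; exact g.closed_s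
      · rw [isCore_iff p _ ht, hp]; exact g.closed_t
  constructor
  · apply Set.Finite.of_finite_image _ beads_injective.injOn
    rw [himg]
    exact (Finset.finite_toSet P).image _
  · rw [← Set.ncard_image_of_injective S beads_injective, himg,
      Set.ncard_image_of_injOn (Phi_walk_inj r t ht hc), Set.ncard_coe_finset,
      Finset.card_powersetCard, Finset.card_range]

end SCCore

open YPartition in
/-- (Ford–Mai–Sze) For coprime `s, t`, the set of self-conjugate `(s,t)`-core
partitions is finite of cardinality `C(⌊s/2⌋+⌊t/2⌋, ⌊s/2⌋)`. -/
theorem count_selfconjugate_st_cores (s t : ℕ) (hs : 0 < s) (ht : 0 < t)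
    (hst : Nat.Coprime s t) :
    {p : YPartition | p.SelfConj ∧ IsCore s p ∧ IsCore t p}.Finite ∧
    {p : YPartition | p.SelfConj ∧ IsCore s p ∧ IsCore t p}.ncard =
      Nat.choose (s / 2 + t / 2) (s / 2) := by
  rcases Nat.even_or_odd' s with ⟨q, hq | hq⟩
  · rcases Nat.even_or_odd' t with ⟨r, hr | hr⟩
    · exfalso
      have : 2 ∣ Nat.gcd s t := Nat.dvd_gcd ⟨q, hq⟩ ⟨r, hr⟩
      rw [hst] at this
      omega
    · have hset : {p : YPartition | p.SelfConj ∧ IsCore s p ∧ IsCore t p}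
          = {p : YPartition | p.SelfConj ∧ IsCore t p ∧ IsCore s p} := by
        ext p
        simp only [Set.mem_setOf_eq]
        tauto
      rw [hset]
      subst hr
      have := SCCore.main_odd r s hs hst.symm
      rw [show (2 * r + 1) / 2 = r by omega, Nat.choose_symm_add, add_comm (s / 2)]
      exact this
  · subst hq
    have := SCCore.main_odd q t ht hst
    rw [show (2 * q + 1) / 2 = q by omega]
    exact this
end

section
/- Let s and t be coprime positive integers. Then there exists an (s,t)-core partition λ that is largest under containment: for every (s,t)-core partition μ, one has μ_i ≤ λ_i for all 1 ≤ i ≤ ℓ(μ), where ℓ(μ) is the number of parts of μ (equivalently, the Young diagram of every (s,t)-core is contained in the Young diagram of λ). -/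
namespace STCore

/-- Membership in the numerical semigroup generated by `s` and `t`. -/
def InS (s t : ℕ) (z : ℤ) : Prop := ∃ a b : ℕ, z = a * s + b * t

/-- sorted list of runner tops. -/
theorem exists_tops (s : ℕ) (hs : 0 < s) (B : Set ℤ)
    (hBs : ∀ x ∈ B, x - s ∈ B) (hub : ∃ M : ℤ, ∀ x ∈ B, x ≤ M)
    (hlb : ∃ M : ℤ, ∀ x ≤ M, x ∈ B) :
    ∃ e : Fin s → ℤ, StrictMono e ∧ (∀ x : ℤ, ∃ k, ∃ i : ℤ, x = e k + i * s) ∧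
      (∀ k, ∀ i : ℤ, e k + i * s ∈ B ↔ i ≤ 0) ∧
      (∀ k k', (s : ℤ) ∣ e k - e k' → k = k') := by
  classical
  obtain ⟨U, hU⟩ := hub
  obtain ⟨L, hL⟩ := hlb
  have hs' : (0 : ℤ) < s := by exact_mod_cast hs
  have hBn : ∀ n : ℕ, ∀ x ∈ B, x - n * s ∈ B := by
    intro n
    induction n with
    | zero => intro x hx; simpa using hx
    | succ n ih =>
      intro x hx
      have := hBs _ (ih x hx)
      have h2 : x - ((n + 1 : ℕ) : ℤ) * s = x - n * s - s := by push_cast; ring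
      rw [h2]; exact this
  have hT : ∀ r : ℤ, ∃ T : ℤ, (T ∈ B ∧ (s : ℤ) ∣ T - r) ∧
      ∀ z : ℤ, (z ∈ B ∧ (s : ℤ) ∣ z - r) → z ≤ T := by
    intro r
    apply Int.exists_greatest_of_bdd
    · exact ⟨U, fun z hz => hU z hz.1⟩
    · refine ⟨r - (|r| + |L|) * s, hL _ ?_, ?_⟩
      · have h1 : (|r| + |L|) * 1 ≤ (|r| + |L|) * (s : ℤ) :=
          mul_le_mul_of_nonneg_left (by omega) (by positivity)
        have := le_abs_self r
        have := neg_abs_le L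
        linarith
      · exact ⟨-(|r| + |L|), by ring⟩
  choose T hT1 hT2 using hT
  have hTinj : Set.InjOn (fun r : ℕ => T r) (Finset.range s : Set ℕ) := by
    intro a ha b hb hab
    have ha' : a < s := by simpa using ha
    have hb' : b < s := by simpa using hb
    have h1 := (hT1 a).2
    have h2 := (hT1 b).2
    have hab' : T a = T b := hab
    rw [hab'] at h1
    have h3 : (s : ℤ) ∣ (a : ℤ) - b := by
      have := dvd_sub h2 h1
      have e : T b - b - (T b - a) = (a : ℤ) - b := by ring
      rwa [e] at this
    have := Int.eq_zero_of_abs_lt_dvd h3 (by rw [abs_lt]; constructor <;> omega)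
    omega
  set F : Finset ℤ := (Finset.range s).image (fun r : ℕ => T r) with hF
  have hcard : F.card = s := by
    rw [hF, Finset.card_image_of_injOn hTinj, Finset.card_range]
  have hmem : ∀ k, ∃ r : ℕ, r < s ∧ T r = F.orderEmbOfFin hcard k := by
    intro k
    have := F.orderEmbOfFin_mem hcard k
    have this := Finset.mem_image.1 this
    obtain ⟨r, hr, h⟩ := this
    exact ⟨r, by simpa using hr, h⟩
  refine ⟨F.orderEmbOfFin hcard, (F.orderEmbOfFin hcard).strictMono, ?_, ?_, ?_⟩
  · intro x
    have hx0 := Int.emod_nonneg x hs'.ne'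
    have hx1 := Int.emod_lt_of_pos x hs'
    have hin : T ((x % s).toNat : ℕ) ∈ F := by
      rw [hF, Finset.mem_image]
      exact ⟨(x % s).toNat, by simp; omega, rfl⟩
    have : T ((x % s).toNat : ℕ) ∈ Set.range (F.orderEmbOfFin hcard) := by
      rw [Finset.range_orderEmbOfFin]; exact hin
    obtain ⟨k, hk⟩ := this
    refine ⟨k, ?_⟩
    rw [hk]
    have h1 := (hT1 ((x % s).toNat : ℕ)).2
    rw [Int.toNat_of_nonneg hx0] at h1 ⊢
    have h2 : (s : ℤ) ∣ x - x % s := Int.dvd_self_sub_emod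
    obtain ⟨i, hi⟩ := dvd_sub h2 h1
    exact ⟨i, by linarith⟩
  · intro k i
    obtain ⟨r, hr, hk⟩ := hmem k
    rw [← hk]
    constructor
    · intro h
      have := hT2 r _ ⟨h, by
        have := (hT1 r).2
        have e : T r + i * s - r = (T r - r) + i * s := by ring
        rw [e]; exact dvd_add this (dvd_mul_left _ _)⟩
      by_contra hi
      have : 0 < i * s := mul_pos (by omega) hs'
      linarith
    · intro hi
      have := hBn (-i).toNat _ (hT1 r).1
      rw [Int.toNat_of_nonneg (by omega)] at this
      have e : T r + i * s = T r - -i * s := by ring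
      rw [e]; exact this
  · intro k k' h
    obtain ⟨r, hr, hk⟩ := hmem k
    obtain ⟨r', hr', hk'⟩ := hmem k'
    rw [← hk, ← hk'] at h
    have h1 := (hT1 r).2
    have h2 := (hT1 r').2
    have h3 : (s : ℤ) ∣ (r : ℤ) - r' := by
      have := dvd_add (dvd_sub h h1) h2
      have e : T r - T r' - (T r - r) + (T r' - r') = (r : ℤ) - r' := by ring
      rwa [e] at this
    have := Int.eq_zero_of_abs_lt_dvd h3 (by rw [abs_lt]; constructor <;> omega)
    have hrr : r = r' := by omega
    subst hrr
    exact (F.orderEmbOfFin hcard).injective (hk.symm.trans hk')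

/-- The rearrangement map. -/
theorem exists_map (s t : ℕ) (hs : 0 < s) (hst : Nat.Coprime s t) (B : Set ℤ)
    (hBs : ∀ x ∈ B, x - s ∈ B) (hBt : ∀ x ∈ B, x - t ∈ B)
    (hub : ∃ M : ℤ, ∀ x ∈ B, x ≤ M)
    (hlb : ∃ M : ℤ, ∀ x ≤ M, x ∈ B) (hne : ∃ c : ℤ, c < 0 ∧ c ∉ B) :
    ∃ m : ℤ, ∃ f : ℤ → ℤ, Function.Injective f ∧
      (∀ x ∈ B, 0 ≤ x → InS s t (f x) ∧ f x ≤ m) ∧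
      (∀ x, x ∉ B → x < 0 → ¬ InS s t (f x) ∧ m < f x) := by
  classical
  obtain ⟨e, emono, ecov, eB, einj⟩ := exists_tops s hs B hBs hub hlb
  have hs' : (0 : ℤ) < s := by exact_mod_cast hs
  have hcop : IsCoprime (s : ℤ) (t : ℤ) := Nat.isCoprime_iff_coprime.mpr hst
  -- gaps at most t
  have hgap : ∀ (k : ℕ) (hk : k + 1 < s), e ⟨k + 1, hk⟩ ≤ e ⟨k, by omega⟩ + t := by
    intro k hk
    by_contra hcon
    push Not at hcon
    have hall : ∀ q : ℕ, ∃ j : Fin s, k < j.val ∧ (s : ℤ) ∣ e j - (e ⟨k + 1, hk⟩ - q * t) := by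
      intro q
      induction q with
      | zero => exact ⟨⟨k + 1, hk⟩, by simp, by simp⟩
      | succ q ih =>
        obtain ⟨j, hj, hd⟩ := ih
        have hjB : e j - t ∈ B := hBt _ (by have := (eB j 0).2 le_rfl; simpa using this)
        obtain ⟨j', i, hji⟩ := ecov (e j - t)
        have hi : i ≤ 0 := by rw [hji] at hjB; exact (eB _ _).1 hjB
        have hmul : i * (s : ℤ) ≤ 0 := mul_nonpos_of_nonpos_of_nonneg hi hs'.le
        have hge : e ⟨k + 1, hk⟩ ≤ e j := emono.monotone (by rw [Fin.le_def]; exact hj)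
        have hlt : e ⟨k, by omega⟩ < e j' := by linarith
        have hlt' := emono.lt_iff_lt.1 hlt
        refine ⟨j', hlt', ?_⟩
        have e1 : e j' - (e ⟨k + 1, hk⟩ - ((q + 1 : ℕ) : ℤ) * t)
            = (e j - (e ⟨k + 1, hk⟩ - q * t)) + (-i) * s := by
          push_cast; linarith
        rw [e1]
        exact dvd_add hd (dvd_mul_left _ _)
    -- find q
    obtain ⟨u, v, huv⟩ := hcop
    set d : ℤ := e ⟨k + 1, hk⟩ - e ⟨0, hs⟩ with hd
    have hq0 := Int.emod_nonneg (d * v) hs'.ne'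
    obtain ⟨j, hj, hdj⟩ := hall ((d * v) % s).toNat
    rw [Int.toNat_of_nonneg hq0] at hdj
    have h2 : (s : ℤ) ∣ d * v - (d * v) % s := Int.dvd_self_sub_emod
    have h3 : (s : ℤ) ∣ e j - e ⟨0, hs⟩ := by
      have h4 : e j - e ⟨0, hs⟩ = (e j - (e ⟨k + 1, hk⟩ - (d * v) % s * t))
          + (d * v - (d * v) % s) * t + (d * u) * s := by
        have : d * u * s + d * v * t = d := by
          calc d * u * s + d * v * t = d * (u * s + v * t) := by ring
            _ = d := by rw [huv, mul_one]
        linarith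
      rw [h4]
      exact dvd_add (dvd_add hdj (dvd_mul_of_dvd_left h2 _)) (dvd_mul_left _ _)
    have := einj _ _ h3
    rw [this] at hj
    simp at hj
  have hgap2 : ∀ (d : ℕ) (k : ℕ) (hk : k + d < s),
      e ⟨k + d, hk⟩ ≤ e ⟨k, by omega⟩ + d * t := by
    intro d
    induction d with
    | zero => intro k hk; simp
    | succ d ih =>
      intro k hk
      have h1 := ih k (by omega)
      have h2 := hgap (k + d) (by omega)
      have h3 : e ⟨k + (d + 1), hk⟩ = e ⟨k + d + 1, by omega⟩ := rfl
      rw [h3]; push_cast; linarith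
  have hgap3 : ∀ k k' : Fin s, k ≤ k' → e k' ≤ e k + ((k' : ℤ) - k) * t := by
    intro k k' h
    have h0 : k.val ≤ k'.val := h
    have h1 := hgap2 (k'.val - k.val) k.val (by have := k'.2; omega)
    have h2 : (⟨k.val + (k'.val - k.val), by have := k'.2; omega⟩ : Fin s) = k' := by
      ext; simp; omega
    rw [h2] at h1
    rw [Nat.cast_sub h0] at h1
    exact h1
  -- threshold index
  have hex : ∃ k0 : Fin s, e k0 < 0 ∧ ∀ k, e k < 0 → k ≤ k0 := by
    obtain ⟨c, hc, hcB⟩ := hne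
    obtain ⟨k, i, hki⟩ := ecov c
    have hi : 0 < i := by
      by_contra h
      exact hcB (hki ▸ (eB k i).2 (by omega))
    have : 0 < i * s := mul_pos hi hs'
    have hk : e k < 0 := by linarith
    have hfin : (Finset.univ.filter (fun k => e k < 0)).Nonempty := ⟨k, by simp [hk]⟩
    refine ⟨(Finset.univ.filter (fun k => e k < 0)).max' hfin, ?_, ?_⟩
    · have := Finset.max'_mem _ hfin
      simpa using this
    · intro k hk
      exact Finset.le_max' _ _ (by simp [hk])
  obtain ⟨k0, hk0, hk0max⟩ := hex
  choose κ ι hκ using ecov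
  have key : ∀ x, e k0 + ((s : ℤ) - 1 - k0) * t - (((s : ℤ) - 1 - κ x) * t - ι x * s)
      = x + (e k0 + ((κ x : ℤ) - k0) * t - e (κ x)) := by
    intro x
    have := hκ x
    linarith
  refine ⟨e k0 + ((s : ℤ) - 1 - k0) * t, fun x => ((s : ℤ) - 1 - κ x) * t - ι x * s, ?_, ?_, ?_⟩
  · intro x y hxy
    have hxy' : ((s : ℤ) - 1 - κ x) * t - ι x * s = ((s : ℤ) - 1 - κ y) * t - ι y * s := hxy
    have h1 : (s : ℤ) ∣ ((κ x : ℤ) - κ y) * t := ⟨ι y - ι x, by linarith⟩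
    have h2 : (s : ℤ) ∣ (κ x : ℤ) - κ y := hcop.dvd_of_dvd_mul_right h1
    have hx2 := (κ x).2
    have hy2 := (κ y).2
    have h3 := Int.eq_zero_of_abs_lt_dvd h2 (by rw [abs_lt]; constructor <;> omega)
    have h4 : κ x = κ y := by ext; omega
    rw [h4] at hxy'
    have h5 : ι x = ι y := by
      have : ι x * (s : ℤ) = ι y * s := by linarith
      exact mul_right_cancel₀ hs'.ne' this
    rw [hκ x, hκ y, h4, h5]
  · intro x hx hx0
    have hi : ι x ≤ 0 := by rw [hκ x] at hx; exact (eB _ _).1 hx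
    constructor
    · refine ⟨(-ι x).toNat, s - 1 - (κ x).val, ?_⟩
      have := (κ x).2
      rw [Int.toNat_of_nonneg (by omega), Nat.cast_sub (by omega), Nat.cast_sub (by omega)]
      push_cast; ring
    · have hmul : ι x * (s : ℤ) ≤ 0 := mul_nonpos_of_nonpos_of_nonneg hi hs'.le
      have hpos : 0 ≤ e (κ x) := by have := hκ x; linarith
      have hlt : k0 ≤ κ x := (emono.lt_iff_lt.1 (hk0.trans_le hpos)).le
      have h1 := hgap3 k0 (κ x) hlt
      have h2 := key x
      show ((s : ℤ) - 1 - κ x) * t - ι x * s ≤ _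
      linarith
  · intro x hx hx0
    have hi : 0 < ι x := by
      by_contra h
      exact hx (by rw [hκ x]; exact (eB _ _).2 (by omega))
    constructor
    · rintro ⟨a, b, hab⟩
      have hab' : ((s : ℤ) - 1 - κ x) * t - ι x * s = a * s + b * t := hab
      have h1 : ((s : ℤ) - 1 - κ x - b) * t = (a + ι x) * s := by linarith
      have h2 : (s : ℤ) ∣ (s : ℤ) - 1 - κ x - b :=
        hcop.dvd_of_dvd_mul_right ⟨a + ι x, by linarith⟩
      have h3 : 0 < ((s : ℤ) - 1 - κ x - b) * t := by
        rw [h1]; exact mul_pos (by omega) hs'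
      have h4 : 0 < (s : ℤ) - 1 - κ x - b := pos_of_mul_pos_left h3 (by positivity)
      have := Int.le_of_dvd h4 h2
      omega
    · have hmul : 0 < ι x * (s : ℤ) := mul_pos hi hs'
      have hneg : e (κ x) < 0 := by have := hκ x; linarith
      have h1 := hgap3 (κ x) k0 (hk0max _ hneg)
      have h2 := key x
      show _ < ((s : ℤ) - 1 - κ x) * t - ι x * s
      linarith

open YPartition

theorem conj_set (p : YPartition) (j : ℕ) : ∃ c, ∀ i, j < p.parts i ↔ i < c := by
  classical
  obtain ⟨N, hN⟩ := p.finite_support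
  have hex : ∃ c, p.parts c ≤ j := ⟨N, by rw [hN N le_rfl]; omega⟩
  refine ⟨Nat.find hex, fun i => ?_⟩
  constructor
  · intro h
    by_contra hc
    have := p.antitone (not_lt.1 hc)
    have := Nat.find_spec hex
    omega
  · intro h
    have := Nat.find_min hex h
    omega

theorem lt_conj (p : YPartition) (i j : ℕ) : i < p.conj j ↔ j < p.parts i := by
  obtain ⟨c, hc⟩ := conj_set p j
  have : {i : ℕ | j < p.parts i} = Set.Iio c := by
    ext i; simp [hc]
  have h2 : p.conj j = c := by
    unfold YPartition.conj
    rw [this, ← Finset.coe_Iio, Set.ncard_coe_finset]; simp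
  rw [h2, hc]

/-- beta set -/
def beta (p : YPartition) : Set ℤ := {z | ∃ i : ℕ, z = p.parts i - i - 1}

theorem not_mem_beta (p : YPartition) (j : ℕ) : ((j : ℤ) - p.conj j) ∉ beta p := by
  rintro ⟨i, hi⟩
  have := lt_conj p i j
  by_cases h : j < p.parts i
  · have := this.2 h; omega
  · have : ¬ i < p.conj j := fun h' => h (this.1 h')
    omega

theorem beta_cover (p : YPartition) (z : ℤ) (hz : z ∉ beta p) : ∃ j : ℕ, z = j - p.conj j := by
  classical
  have hex : ∃ i : ℕ, (p.parts i : ℤ) - i - 1 < z := by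
    obtain ⟨N, hN⟩ := p.finite_support
    refine ⟨N + (-z).toNat, ?_⟩
    rw [hN _ (by omega)]
    push_cast
    omega
  have h1 := Nat.find_spec hex
  have h2 : ∀ m, m < Nat.find hex → z < (p.parts m : ℤ) - m - 1 := by
    intro m hm
    have h3 := Nat.find_min hex hm
    have h4 : z ≠ (p.parts m : ℤ) - m - 1 := fun h => hz ⟨m, h⟩
    omega
  set i := Nat.find hex with hi
  refine ⟨(z + i).toNat, ?_⟩
  have hj : (((z + i).toNat : ℕ) : ℤ) = z + i := Int.toNat_of_nonneg (by omega)
  have hc : p.conj (z + i).toNat = i := by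
    apply le_antisymm
    · by_contra h
      have := (lt_conj p i _).1 (not_le.1 h)
      omega
    · by_contra h
      have hlt := not_le.1 h
      have h3 := h2 (i - 1) (by omega)
      have h4 : ¬ (i - 1 < p.conj (z + i).toNat) := by omega
      rw [lt_conj] at h4
      omega
  rw [hj, hc]; ring

theorem hook_eq (p : YPartition) (i j : ℕ) (h : j < p.parts i) :
    (p.hook i j : ℤ) = ((p.parts i : ℤ) - i - 1) - (j - p.conj j) := by
  have := (lt_conj p i j).2 h
  unfold YPartition.hook
  omega

theorem isCore_iff (p : YPartition) (t : ℕ) :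
    IsCore t p ↔ ∀ x ∈ beta p, x - t ∈ beta p := by
  constructor
  · rintro h x ⟨i, rfl⟩
    by_contra hx
    obtain ⟨j, hj⟩ := beta_cover p _ hx
    by_cases hji : j < p.parts i
    · refine h i j hji ?_
      have := hook_eq p i j hji
      omega
    · have := lt_conj p i j
      have : ¬ i < p.conj j := fun h' => hji (this.1 h')
      omega
  · intro h i j hij hh
    have hji : j < p.parts i := hij
    have h1 := hook_eq p i j hji
    have h2 := h _ ⟨i, rfl⟩
    refine not_mem_beta p j ?_
    have h3 : ((j : ℤ) - p.conj j) = ((p.parts i : ℤ) - i - 1) - t := by omega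
    rw [h3]; exact h2

/-- the semigroup as a predicate on naturals. -/
def SN (s t : ℕ) (x : ℕ) : Prop := InS s t x

theorem SN_large (s t : ℕ) (hst : Nat.Coprime s t) (x : ℕ) (hx : s * t ≤ x) : SN s t x := by
  obtain ⟨a, b, h⟩ := Nat.exists_add_mul_eq_of_gcd_dvd_of_mul_pred_le s t x
    (by rw [hst.gcd_eq_one]; exact one_dvd _)
    (le_trans (Nat.mul_le_mul (Nat.pred_le _) (Nat.pred_le _)) hx)
  exact ⟨a, b, by exact_mod_cast h.symm⟩

theorem SN_inf (s t : ℕ) (hst : Nat.Coprime s t) : (Set.ofPred (SN s t)).Infinite := by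
  apply Set.infinite_of_not_bddAbove
  rintro ⟨M, hM⟩
  have := hM (SN_large s t hst (s * t + M + 1) (by omega))
  omega

theorem gaps_fin (s t : ℕ) (hst : Nat.Coprime s t) (P : ℕ → Prop) :
    {x : ℕ | ¬ SN s t x ∧ P x}.Finite := by
  apply (Set.finite_Iio (s * t)).subset
  intro x hx
  by_contra h
  exact hx.1 (SN_large s t hst x (by simpa using h))

/-- the largest core -/
noncomputable def big (s t : ℕ) (hst : Nat.Coprime s t) : YPartition where
  parts i := {x : ℕ | ¬ SN s t x ∧ Nat.nth (SN s t) i < x}.ncard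
  antitone := by
    intro i j hij
    apply Set.ncard_le_ncard _ (gaps_fin s t hst _)
    intro x hx
    exact ⟨hx.1, ((Nat.nth_strictMono (SN_inf s t hst)).monotone hij).trans_lt hx.2⟩
  finite_support := by
    refine ⟨s * t, fun i hi => ?_⟩
    have : {x : ℕ | ¬ SN s t x ∧ Nat.nth (SN s t) i < x} = ∅ := by
      ext x
      simp only [Set.mem_ofPred_eq, Set.mem_empty_iff_false, iff_false, not_and]
      intro h1 h2
      have h3 := (Nat.nth_strictMono (SN_inf s t hst)).id_le i
      simp only [id] at h3
      exact h1 (SN_large s t hst x (by omega))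
    rw [this]; simp

theorem big_parts (s t : ℕ) (hst : Nat.Coprime s t) (i : ℕ) :
    (big s t hst).parts i + Nat.nth (SN s t) i = {x : ℕ | ¬ SN s t x ∧ True}.ncard + i := by
  classical
  have hc : Nat.count (SN s t) (Nat.nth (SN s t) i) = i :=
    Nat.count_nth_of_infinite (SN_inf s t hst) i
  have hm := Nat.nth_mem_of_infinite (SN_inf s t hst) i
  set n := Nat.nth (SN s t) i with hn
  have h1 : {x : ℕ | ¬ SN s t x ∧ True} =
      {x : ℕ | ¬ SN s t x ∧ n < x} ∪ {x : ℕ | ¬ SN s t x ∧ x < n} := by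
    ext x
    simp only [Set.mem_ofPred_eq, Set.mem_union, and_true]
    constructor
    · intro h
      have : x ≠ n := fun h' => h (h' ▸ hm)
      rcases lt_or_gt_of_ne this with h' | h'
      · exact Or.inr ⟨h, h'⟩
      · exact Or.inl ⟨h, h'⟩
    · rintro (h | h) <;> exact h.1
  have h2 : {x : ℕ | ¬ SN s t x ∧ x < n} = ((Finset.range n).filter (fun x => ¬ SN s t x) : Set ℕ) := by
    ext x; simp [and_comm]
  rw [h1, Set.ncard_union_eq _ (gaps_fin s t hst _) (gaps_fin s t hst _), h2, Set.ncard_coe_finset]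
  · have h3 := Finset.card_filter_add_card_filter_not (s := Finset.range n) (SN s t)
    rw [← Nat.count_eq_card_filter_range, hc, Finset.card_range] at h3
    have h4 : (big s t hst).parts i = {x : ℕ | ¬ SN s t x ∧ n < x}.ncard := rfl
    rw [h4]
    omega
  · rw [Set.disjoint_left]
    intro x hx hx'
    have := hx.2
    have := hx'.2
    omega

theorem big_beta (s t : ℕ) (hst : Nat.Coprime s t) (z : ℤ) :
    z ∈ beta (big s t hst) ↔
      InS s t (({x : ℕ | ¬ SN s t x ∧ True}.ncard : ℤ) - 1 - z) := by
  classical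
  constructor
  · rintro ⟨i, rfl⟩
    have h1 := big_parts s t hst i
    have hm : InS s t ((Nat.nth (SN s t) i : ℕ) : ℤ) := Nat.nth_mem_of_infinite (SN_inf s t hst) i
    convert hm using 1
    omega
  · intro h
    obtain ⟨a, b, hab⟩ := h
    have hS : SN s t (a * s + b * t) := ⟨a, b, by push_cast; rfl⟩
    refine ⟨Nat.count (SN s t) (a * s + b * t), ?_⟩
    have h1 := big_parts s t hst (Nat.count (SN s t) (a * s + b * t))
    rw [Nat.nth_count hS] at h1
    have h2 : ((a * s + b * t : ℕ) : ℤ) = a * s + b * t := by push_cast; rfl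
    omega

theorem le_big (s t : ℕ) (hs : 0 < s) (hst : Nat.Coprime s t) (p : YPartition)
    (h1 : IsCore s p) (h2 : IsCore t p) (i : ℕ) : p.parts i ≤ (big s t hst).parts i := by
  classical
  rcases Nat.eq_zero_or_pos (p.parts i) with h0 | h0
  · omega
  rw [isCore_iff] at h1 h2
  set n : ℤ := (p.parts i : ℤ) - i - 1 with hn
  have hneg : ∀ j, j < p.parts i → ((j : ℤ) - p.conj j - n) < 0 := by
    intro j hj
    have := (lt_conj p i j).2 hj
    omega
  obtain ⟨m, f, finj, fB, fC⟩ := exists_map s t hs hst {x | x + n ∈ beta p}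
    (by intro x hx
        have := h1 _ hx
        show x - s + n ∈ beta p
        convert this using 1; ring)
    (by intro x hx
        have := h2 _ hx
        show x - t + n ∈ beta p
        convert this using 1; ring)
    (by refine ⟨p.parts 0 - n, ?_⟩
        rintro x ⟨k, hk⟩
        have := p.antitone (Nat.zero_le k)
        omega)
    (by obtain ⟨N, hN⟩ := p.finite_support
        refine ⟨-N - 1 - n, fun x hx => ⟨(-(x + n) - 1).toNat, ?_⟩⟩
        have h3 : (((-(x + n) - 1).toNat : ℕ) : ℤ) = -(x + n) - 1 :=
          Int.toNat_of_nonneg (by omega)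
        rw [hN _ (by omega), h3]
        push_cast; ring)
    (by refine ⟨((0 : ℕ) : ℤ) - p.conj 0 - n, hneg 0 h0, ?_⟩
        intro h
        apply not_mem_beta p 0
        have h' : ((0 : ℕ) : ℤ) - p.conj 0 - n + n ∈ beta p := h
        simpa using h')
  have hInS : ∀ z, InS s t z → 0 ≤ z := by
    rintro z ⟨a, b, rfl⟩; positivity
  -- elements of B
  have hA : ∀ k, k ≤ i → SN s t (f ((p.parts k : ℤ) - k - 1 - n)).toNat ∧
      (((f ((p.parts k : ℤ) - k - 1 - n)).toNat : ℕ) : ℤ) = f ((p.parts k : ℤ) - k - 1 - n) ∧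
      f ((p.parts k : ℤ) - k - 1 - n) ≤ m := by
    intro k hk
    have h3 := fB ((p.parts k : ℤ) - k - 1 - n) ⟨k, by ring⟩
      (by have := p.antitone hk; omega)
    have h4 := Int.toNat_of_nonneg (hInS _ h3.1)
    refine ⟨?_, h4, h3.2⟩
    show InS s t _
    rw [h4]; exact h3.1
  have hm0 : 0 ≤ m := by
    have := hA i le_rfl
    omega
  have hcount : i + 1 ≤ Nat.count (SN s t) (m.toNat + 1) := by
    rw [Nat.count_eq_card_filter_range]
    have := Finset.card_le_card_of_injOn (s := Finset.range (i + 1))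
      (t := (Finset.range (m.toNat + 1)).filter (SN s t))
      (fun k => (f ((p.parts k : ℤ) - k - 1 - n)).toNat)
      (by intro k hk
          have hk' : k < i + 1 := by simpa using hk
          have h3 := hA k (by omega)
          simp only [Finset.coe_filter, Finset.mem_range, Set.mem_ofPred_eq]
          exact ⟨by omega, h3.1⟩)
      (by intro k hk k' hk' hkk
          have hk1 : k < i + 1 := by simpa using hk
          have hk1' : k' < i + 1 := by simpa using hk'
          have h3 := hA k (by omega)
          have h3' := hA k' (by omega)
          have hkk' : (f ((p.parts k : ℤ) - k - 1 - n)).toNat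
            = (f ((p.parts k' : ℤ) - k' - 1 - n)).toNat := hkk
          have h4 : f ((p.parts k : ℤ) - k - 1 - n) = f ((p.parts k' : ℤ) - k' - 1 - n) := by
            omega
          have h5 := finj h4
          rcases lt_trichotomy k k' with h | h | h
          · have := p.antitone h.le; omega
          · exact h
          · have := p.antitone h.le; omega)
    simpa using this
  have hnth : Nat.nth (SN s t) i < m.toNat + 1 := Nat.nth_lt_of_lt_count (by omega)
  have hC : ∀ j, j < p.parts i → ¬ InS s t (f ((j : ℤ) - p.conj j - n)) ∧
      m < f ((j : ℤ) - p.conj j - n) := by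
    intro j hj
    apply fC _ _ (hneg j hj)
    intro h
    apply not_mem_beta p j
    have h' : (j : ℤ) - p.conj j - n + n ∈ beta p := h
    simpa using h'
  have hfin : {x : ℕ | ¬ SN s t x ∧ Nat.nth (SN s t) i < x}.Finite := gaps_fin s t hst _
  have hle := Set.ncard_le_ncard_of_injOn (s := (Finset.range (p.parts i) : Set ℕ))
    (t := {x : ℕ | ¬ SN s t x ∧ Nat.nth (SN s t) i < x})
    (fun j : ℕ => (f ((j : ℤ) - p.conj j - n)).toNat)
    (by intro j hj
        have hj' : j < p.parts i := by simpa using hj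
        have h3 := hC j hj'
        have h4 : (((f ((j : ℤ) - p.conj j - n)).toNat : ℕ) : ℤ) = f ((j : ℤ) - p.conj j - n) :=
          Int.toNat_of_nonneg (by omega)
        refine ⟨?_, by omega⟩
        show ¬ InS s t _
        rw [h4]; exact h3.1)
    (by intro j hj j' hj' hjj
        have hj1 : j < p.parts i := by simpa using hj
        have hj1' : j' < p.parts i := by simpa using hj'
        have h3 := hC j hj1
        have h3' := hC j' hj1'
        have hjj' : (f ((j : ℤ) - p.conj j - n)).toNat = (f ((j' : ℤ) - p.conj j' - n)).toNat := hjj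
        have h4 : f ((j : ℤ) - p.conj j - n) = f ((j' : ℤ) - p.conj j' - n) := by omega
        have h5 := finj h4
        have hanti : ∀ a b : ℕ, a ≤ b → p.conj b ≤ p.conj a := by
          intro a b hab
          by_contra h
          have h6 := (lt_conj p _ b).1 (not_le.1 h)
          have h7 := (lt_conj p (p.conj a) a).2 (by omega)
          omega
        rcases lt_trichotomy j j' with h | h | h
        · have := hanti _ _ h.le; omega
        · exact h
        · have := hanti _ _ h.le; omega)
    hfin
  rw [Set.ncard_coe_finset, Finset.card_range] at hle
  exact hle

end STCore

open YPartition in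
/-- (Vandehey) For coprime `s, t`, there is an `(s,t)`-core partition that contains
every `(s,t)`-core partition (row by row). -/
theorem largest_st_core_containment (s t : ℕ) (hs : 0 < s) (ht : 0 < t)
    (hst : Nat.Coprime s t) :
    ∃ l : YPartition, IsCore s l ∧ IsCore t l ∧
      ∀ p : YPartition, IsCore s p → IsCore t p → ∀ i : ℕ, p.parts i ≤ l.parts i := by
  refine ⟨STCore.big s t hst, ?_, ?_, fun p h1 h2 i => STCore.le_big s t hs hst p h1 h2 i⟩
  · rw [STCore.isCore_iff]
    intro x hx
    rw [STCore.big_beta] at hx ⊢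
    obtain ⟨a, b, h⟩ := hx
    exact ⟨a + 1, b, by push_cast; linarith⟩
  · rw [STCore.isCore_iff]
    intro x hx
    rw [STCore.big_beta] at hx ⊢
    obtain ⟨a, b, h⟩ := hx
    exact ⟨a, b + 1, by push_cast; linarith⟩
end

section
/- Let t be a positive integer and let λ be a self-conjugate partition. Then λ is a t-core if and only if the following two conditions hold: (1) if h ∈ MD(λ) and h > 2t, then h − 2t ∈ MD(λ); (2) if h, h' ∈ MD(λ) (not necessarily distinct), then h + h' is not divisible by 2t. -/
namespace YPartition

theorem symm_of_selfConj (p : YPartition) (hp : p.SelfConj) {i j : ℕ} (h : j < p.parts i) :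
    i < p.parts j := by
  rw [← hp j]
  obtain ⟨N, hN⟩ := p.finite_support
  have hfin : {k : ℕ | j < p.parts k}.Finite := by
    apply (Set.finite_Iio N).subset
    intro k hk
    simp only [Set.mem_setOf_eq] at hk
    simp only [Set.mem_Iio]
    by_contra hc
    have := hN k (by omega)
    omega
  have hsub : (↑(Finset.range (i + 1)) : Set ℕ) ⊆ {k : ℕ | j < p.parts k} := by
    intro k hk
    simp only [Finset.coe_range, Set.mem_Iio] at hk
    have := p.antitone (show k ≤ i by omega)
    simp only [Set.mem_setOf_eq]
    omega
  have h1 := Set.ncard_le_ncard hsub hfin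
  rw [Set.ncard_coe_finset, Finset.card_range] at h1
  exact h1

/-- `m` is a bead: `m = λ_i - i` for some row `i`. -/
def Bead (p : YPartition) (m : ℤ) : Prop := ∃ i : ℕ, (p.parts i : ℤ) - i = m

theorem bead_or (p : YPartition) (hp : p.SelfConj) (m : ℤ) : p.Bead m ∨ p.Bead (1 - m) := by
  classical
  by_contra hcon
  push Not at hcon
  obtain ⟨h1, h2⟩ := hcon
  have hex : ∃ i : ℕ, (p.parts i : ℤ) - i ≤ m := by
    refine ⟨p.parts 0 + m.natAbs, ?_⟩
    have := p.antitone (Nat.zero_le (p.parts 0 + m.natAbs))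
    omega
  have hi := Nat.find_spec hex
  have hmin := fun k => Nat.find_min (m := k) hex
  generalize Nat.find hex = i at hi hmin
  have hlt : (p.parts i : ℤ) - i < m := lt_of_le_of_ne hi fun h => h1 ⟨i, h⟩
  obtain ⟨j, hj⟩ : ∃ j : ℕ, (j : ℤ) = i + m - 1 := ⟨(i + m - 1).toNat, by omega⟩
  apply h2
  refine ⟨j, ?_⟩
  have hle : p.parts j ≤ i := by
    by_contra hc
    have := p.symm_of_selfConj hp (i := j) (j := i) (by omega)
    omega
  have hge : i ≤ p.parts j := by
    rcases i with _ | k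
    · omega
    · have := hmin k (by omega)
      exact p.symm_of_selfConj hp (by omega)
  omega

theorem not_bead_both (p : YPartition) (hp : p.SelfConj) {m : ℤ} (h1 : p.Bead m)
    (h2 : p.Bead (1 - m)) : False := by
  obtain ⟨i, hi⟩ := h1
  obtain ⟨j, hj⟩ := h2
  by_cases h : j < p.parts i
  · have := p.symm_of_selfConj hp h
    omega
  · have : ¬ i < p.parts j := fun h' => h (p.symm_of_selfConj hp h')
    omega

theorem isCore_iff (p : YPartition) (hp : p.SelfConj) (t : ℕ) (ht : 0 < t) :
    IsCore t p ↔ ∀ a b : ℤ, p.Bead a → p.Bead b → a + b - 1 ≠ t := by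
  constructor
  · rintro h a b ⟨i, hi⟩ ⟨j, hj⟩ hab
    by_cases hc : j < p.parts i
    · apply h i j hc
      have := p.symm_of_selfConj hp hc
      rw [hook, hp j]
      omega
    · have : ¬ i < p.parts j := fun h' => hc (p.symm_of_selfConj hp h')
      omega
  · intro h i j hc hk
    have hc' : j < p.parts i := hc
    have := p.symm_of_selfConj hp hc'
    rw [hook, hp j] at hk
    exact h _ _ ⟨i, rfl⟩ ⟨j, rfl⟩ (by omega)

theorem mem_MD_iff (p : YPartition) (hp : p.SelfConj) (h : ℕ) :
    h ∈ p.MD ↔ ∃ m : ℤ, 0 < m ∧ (h : ℤ) = 2 * m - 1 ∧ p.Bead m := by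
  constructor
  · rintro ⟨i, hi, hh⟩
    rw [hook, hp i] at hh
    exact ⟨(p.parts i : ℤ) - i, by omega, by omega, i, rfl⟩
  · rintro ⟨m, hm, hh, i, hi⟩
    refine ⟨i, by omega, ?_⟩
    rw [hook, hp i]
    omega

end YPartition

open YPartition in
/-- (Ford–Mai–Sze) A self-conjugate partition is a `t`-core iff its multiset of main
diagonal hook lengths `MD(λ)` satisfies: (1) if `h ∈ MD(λ)` and `h > 2t` then
`h − 2t ∈ MD(λ)`; (2) no sum of two (not necessarily distinct) elements of `MD(λ)`
is divisible by `2t`. -/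
theorem selfconjugate_tcore_iff (t : ℕ) (ht : 0 < t) (p : YPartition) (hp : p.SelfConj) :
    IsCore t p ↔
      ((∀ h ∈ p.MD, 2 * t < h → h - 2 * t ∈ p.MD) ∧
       (∀ h ∈ p.MD, ∀ h' ∈ p.MD, ¬ (2 * t ∣ h + h'))) := by
  rw [isCore_iff p hp t ht]
  constructor
  · intro hcore
    have hstep : ∀ a : ℤ, p.Bead a → p.Bead (a - t) := by
      intro a ha
      rcases p.bead_or hp (a - t) with h | h
      · exact h
      · exact absurd (by ring) (hcore a _ ha h)
    have hsteps : ∀ (k : ℕ) (a : ℤ), p.Bead a → p.Bead (a - t * k) := by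
      intro k
      induction k with
      | zero => intro a ha; simpa using ha
      | succ k ih =>
        intro a ha
        have := hstep _ (ih a ha)
        convert this using 1
        push_cast
        ring
    refine ⟨?_, ?_⟩
    · intro h hh hlt
      rw [mem_MD_iff p hp] at hh ⊢
      obtain ⟨m, hm, hhm, hb⟩ := hh
      exact ⟨m - t, by omega, by omega, hstep m hb⟩
    · rintro h hh h' hh' ⟨k, hk⟩
      rw [mem_MD_iff p hp] at hh hh'
      obtain ⟨m, hm, hhm, hb⟩ := hh
      obtain ⟨m', hm', hhm', hb'⟩ := hh'
      have hkz : (h : ℤ) + h' = 2 * t * k := by exact_mod_cast hk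
      have := hsteps k m hb
      apply p.not_bead_both hp hb'
      convert this using 1
      linarith
  · rintro ⟨h1, h2⟩
    have key : ∀ a b : ℤ, b ≤ a → p.Bead a → p.Bead b → a + b - 1 ≠ t := by
      intro a b hle ha hb hab
      have hma : (2 * a - 1).toNat ∈ p.MD := (mem_MD_iff p hp _).2 ⟨a, by omega, by omega, ha⟩
      by_cases hpos : 0 < b
      · have hmb : (2 * b - 1).toNat ∈ p.MD := (mem_MD_iff p hp _).2 ⟨b, by omega, by omega, hb⟩
        exact h2 _ hma _ hmb ⟨1, by omega⟩
      · have h3 := h1 _ hma (by omega)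
        rw [mem_MD_iff p hp] at h3
        obtain ⟨m, hm, hhm, hbm⟩ := h3
        have : m = 1 - b := by omega
        subst this
        exact p.not_bead_both hp hb hbm
    intro a b ha hb hab
    rcases le_total b a with h | h
    · exact key a b h ha hb hab
    · exact key b a h hb ha (by omega)
end
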